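/- The only pairs (x, y) ∈ ℚ × ℚ satisfying y² = −3x⁶ + 4x⁵ − 26x⁴ + 12x³ − 55x² − 16x + 4 are (x, y) = (0, 2) and (x, y) = (0, −2). -/

import Mathlib

section
open Polynomial NumberField

/-- The cubic polynomial defining the field. -/
noncomputable def pK : ℚ[X] := X ^ 3 - X ^ 2 + 4 * X - 2

lemma pK_natDegree : pK.natDegree = 3 := by
  unfold pK; compute_degree!

lemma pK_monic : pK.Monic := by
  unfold pK; monicity!

lemma pK_no_root (r : ℚ) : r ^ 3 - r ^ 2 + 4 * r - 2 ≠ 0 := by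
  intro h
  have hd : (r.den : ℚ) ≠ 0 := by exact_mod_cast r.den_ne_zero
  have h1 : (r.num : ℚ) ^ 3 - r.num ^ 2 * r.den + 4 * r.num * r.den ^ 2 - 2 * r.den ^ 3 = 0 := by
    have hr : (r.num : ℚ) = r * r.den := by
      rw [mul_comm]; exact (Rat.den_mul_eq_num r).symm
    rw [hr]; linear_combination (r.den : ℚ) ^ 3 * h
  have h2 : (r.num : ℤ) ^ 3 - r.num ^ 2 * r.den + 4 * r.num * r.den ^ 2 - 2 * r.den ^ 3 = 0 := by
    exact_mod_cast h1
  have h3 : ((r.num : ℤ) : ZMod 3) ^ 3 - (r.num : ZMod 3) ^ 2 * (r.den : ZMod 3)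
      + 4 * (r.num : ZMod 3) * (r.den : ZMod 3) ^ 2 - 2 * (r.den : ZMod 3) ^ 3 = 0 := by
    exact_mod_cast congrArg (Int.cast : ℤ → ZMod 3) h2
  have key : ∀ a b : ZMod 3, a ^ 3 - a ^ 2 * b + 4 * a * b ^ 2 - 2 * b ^ 3 = 0 → a = 0 ∧ b = 0 := by
    decide
  obtain ⟨ha, hb⟩ := key _ _ h3
  have ha' : (3 : ℤ) ∣ r.num := (ZMod.intCast_zmod_eq_zero_iff_dvd _ 3).1 ha
  have hb' : 3 ∣ r.den := (ZMod.natCast_eq_zero_iff _ 3).1 hb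
  have := Nat.dvd_gcd (Int.natAbs_dvd_natAbs.2 ha') hb'
  rw [r.reduced.gcd_eq_one] at this
  norm_num at this

lemma pK_irreducible : Irreducible pK := by
  rw [Polynomial.irreducible_iff_roots_eq_zero_of_degree_le_three (by rw [pK_natDegree]; norm_num)
    (by rw [pK_natDegree])]
  rw [Multiset.eq_zero_iff_forall_notMem]
  intro r hr
  have := (Polynomial.mem_roots'.1 hr).2
  apply pK_no_root r
  simpa [pK, IsRoot] using this

instance : Fact (Irreducible pK) := ⟨pK_irreducible⟩

/-- The cubic field of discriminant `-212`. -/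
abbrev KK := AdjoinRoot pK

noncomputable instance : NumberField KK where
  to_charZero := inferInstance
  to_finiteDimensional := (AdjoinRoot.powerBasis pK_monic.ne_zero).finite

/-- The generator. -/
noncomputable def ph : KK := AdjoinRoot.root pK

lemma ph_eq : ph ^ 3 = ph ^ 2 - 4 * ph + 2 := by
  have h : eval₂ (AdjoinRoot.of pK) (AdjoinRoot.root pK) (X ^ 3 - X ^ 2 + 4 * X - 2) = 0 :=
    AdjoinRoot.eval₂_root pK
  simp [eval₂_sub, eval₂_mul, eval₂_add, eval₂_pow] at h
  unfold ph
  linear_combination h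

/-- The power basis indexed by `Fin 3`. -/
noncomputable def BK : Module.Basis (Fin 3) ℚ KK :=
  (AdjoinRoot.powerBasis pK_monic.ne_zero).basis.reindex
    (finCongr (by rw [AdjoinRoot.powerBasis_dim, pK_natDegree]))

lemma BK_apply (i : Fin 3) : BK i = ph ^ (i : ℕ) := by
  simp [BK, ph]

lemma finrank_KK : Module.finrank ℚ KK = 3 := by
  rw [Module.finrank_eq_card_basis BK]; simp

lemma BK_sum (z : KK) : ∃ a b c : ℚ, z = a + b * ph + c * ph ^ 2 := by
  refine ⟨BK.repr z 0, BK.repr z 1, BK.repr z 2, ?_⟩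
  conv_lhs => rw [← BK.sum_repr z]
  simp [Fin.sum_univ_three, BK_apply, Algebra.smul_def]

lemma BK_indep (a b c : ℚ) (h : (a : KK) + b * ph + c * ph ^ 2 = 0) : a = 0 ∧ b = 0 ∧ c = 0 := by
  have := Fintype.linearIndependent_iff.1 BK.linearIndependent ![a, b, c] (by
    simp [Fin.sum_univ_three, BK_apply, Algebra.smul_def]; exact h)
  exact ⟨this 0, this 1, this 2⟩

lemma BK_left : Algebra.leftMulMatrix BK ph = !![0, 0, 2; 1, 0, -4; 0, 1, 1] := by
  have h0 : ph * BK 0 = BK 1 := by simp [BK_apply]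
  have h1 : ph * BK 1 = BK 2 := by simp [BK_apply]; ring
  have h2 : ph * BK 2 = (2 : ℚ) • BK 0 + (-4 : ℚ) • BK 1 + BK 2 := by
    simp [BK_apply, Algebra.smul_def]; linear_combination ph_eq
  ext i j
  rw [Algebra.leftMulMatrix_eq_repr_mul]
  fin_cases j
  · simp only [Fin.zero_eta, h0]; fin_cases i <;> simp
  · simp only [Fin.mk_one, h1]; fin_cases i <;> simp
  · simp only [Fin.reduceFinMk, h2]; fin_cases i <;> simp

lemma BK_leftAll (a b c : ℚ) : Algebra.leftMulMatrix BK ((a : KK) + b * ph + c * ph ^ 2) =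
    !![a, 2 * c, 2 * b + 2 * c; b, a - 4 * c, - 4 * b - 2 * c; c, b + c, a + b - 3 * c] := by
  have h1 : ∀ q : ℚ, Algebra.leftMulMatrix BK (q : KK) = algebraMap ℚ _ q := by
    intro q
    exact (Algebra.leftMulMatrix BK).commutes q
  rw [map_add, map_add, map_mul, map_mul, map_pow, h1, h1, h1, BK_left]
  ext i j
  fin_cases i <;> fin_cases j <;>
  simp [pow_two, Matrix.mul_apply, Matrix.algebraMap_matrix_apply] <;> ring

lemma trace_KK (a b c : ℚ) : Algebra.trace ℚ KK ((a : KK) + b * ph + c * ph ^ 2) =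
    3 * a + b - 7 * c := by
  rw [Algebra.trace_eq_matrix_trace BK, BK_leftAll]
  simp [Matrix.trace, Fin.sum_univ_three]; ring

lemma norm_KK (a b c : ℚ) : Algebra.norm ℚ ((a : KK) + b * ph + c * ph ^ 2) =
    a * ((a - 4 * c) * (a + b - 3 * c) - (- 4 * b - 2 * c) * (b + c))
    - 2 * c * (b * (a + b - 3 * c) - (- 4 * b - 2 * c) * c)
    + (2 * b + 2 * c) * (b * (b + c) - (a - 4 * c) * c) := by
  rw [Algebra.norm_eq_matrix_det BK, BK_leftAll, Matrix.det_fin_three]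
  simp; ring

lemma discr_BK : Algebra.discr ℚ BK = -212 := by
  have h3 : ph ^ 3 = ((2 : ℚ) : KK) + ((-4 : ℚ) : KK) * ph + ((1 : ℚ) : KK) * ph ^ 2 := by
    push_cast; linear_combination ph_eq
  have h4 : ph ^ 4 = ((2 : ℚ) : KK) + ((-2 : ℚ) : KK) * ph + ((-3 : ℚ) : KK) * ph ^ 2 := by
    push_cast; linear_combination (ph + 1) * ph_eq
  have t0 : Algebra.trace ℚ KK 1 = 3 := by
    have := trace_KK 1 0 0; simpa using this
  have t1 : Algebra.trace ℚ KK ph = 1 := by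
    have := trace_KK 0 1 0; simpa using this
  have t2 : Algebra.trace ℚ KK (ph ^ 2) = -7 := by
    have := trace_KK 0 0 1; simpa using this
  have t3 : Algebra.trace ℚ KK (ph ^ 3) = -5 := by
    rw [h3, trace_KK]; norm_num
  have t4 : Algebra.trace ℚ KK (ph ^ 4) = 25 := by
    rw [h4, trace_KK]; norm_num
  have e : ∀ i j : Fin 3, Algebra.traceMatrix ℚ BK i j = Algebra.trace ℚ KK (ph ^ ((i : ℕ) + j)) := by
    intro i j
    rw [Algebra.traceMatrix_apply, Algebra.traceForm_apply, BK_apply, BK_apply, pow_add]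
  rw [Algebra.discr_def, Matrix.det_fin_three]
  simp only [e]
  simp [t0, t1, t2, t3, t4]
  norm_num

end

section
open Polynomial NumberField

lemma ph_isIntegral : IsIntegral ℤ ph := by
  refine ⟨X ^ 3 - X ^ 2 + 4 * X - 2, by monicity!, ?_⟩
  simp [eval₂_sub, eval₂_mul, eval₂_add, eval₂_pow]
  linear_combination ph_eq

/-- The generator as an algebraic integer. -/
noncomputable def pho : 𝓞 KK := ⟨ph, ph_isIntegral⟩

lemma pho_coe : (pho : KK) = ph := rfl

lemma pho_eq : pho ^ 3 = pho ^ 2 - 4 * pho + 2 := by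
  apply RingOfIntegers.ext
  exact ph_eq

lemma discr_KK : ∃ m : ℤ, m ^ 2 * discr KK = -212 := by
  classical
  have hc : Fintype.card (Module.Free.ChooseBasisIndex ℤ (𝓞 KK)) = 3 := by
    rw [← Module.finrank_eq_card_basis (integralBasis KK), finrank_KK]
  let ε := Fintype.equivFinOfCardEq hc
  let b := (integralBasis KK).reindex ε
  let P : Matrix (Fin 3) (Fin 3) ℤ := fun i j =>
    (RingOfIntegers.basis KK).repr (pho ^ (j : ℕ)) (ε.symm i)
  have hP : ∀ j, BK j = ∑ i, (P i j : ℚ) • b i := by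
    intro j
    have h1 := b.sum_repr (BK j)
    rw [← h1]
    refine Finset.sum_congr rfl fun i _ => ?_
    congr 1
    have h2 : BK j = algebraMap (𝓞 KK) KK (pho ^ (j : ℕ)) := by
      rw [BK_apply, map_pow]; rfl
    simp only [b, Module.Basis.repr_reindex, Finsupp.mapDomain_equiv_apply]
    rw [h2, integralBasis_repr_apply]
    rfl
  refine ⟨P.det, ?_⟩
  have h := Algebra.discr_of_matrix_vecMul (A := ℚ) (b : Fin 3 → KK) (P.map (Int.cast : ℤ → ℚ))
  have e1 : Matrix.vecMul (b : Fin 3 → KK) ((P.map (Int.cast : ℤ → ℚ)).map (algebraMap ℚ KK)) = BK := by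
    funext j
    rw [hP j]
    simp [Matrix.vecMul, dotProduct, Algebra.smul_def, mul_comm]
  rw [e1, discr_BK] at h
  have e2 : Algebra.discr ℚ b = (discr KK : ℚ) := by
    rw [coe_discr]
    have := Algebra.discr_reindex ℚ (integralBasis KK) ε
    rw [← this]
    congr 1
    funext i; simp [b]
  have e3 : (P.map (Int.cast : ℤ → ℚ)).det = (P.det : ℚ) := by
    have := (Int.castRingHom ℚ).map_det P
    simpa using this.symm
  rw [e2, e3] at h
  exact_mod_cast h.symm

lemma discr_neg : discr KK < 0 := by
  obtain ⟨m, hm⟩ := discr_KK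
  by_contra h
  push Not at h
  nlinarith [sq_nonneg m]

lemma abs_discr_le : |discr KK| ≤ 212 := by
  obtain ⟨m, hm⟩ := discr_KK
  have h1 : 1 ≤ m ^ 2 := by
    rcases eq_or_ne m 0 with rfl | h
    · norm_num at hm
    · have := sq_pos_of_ne_zero h; omega
  rw [abs_of_neg discr_neg]
  nlinarith [discr_neg]

lemma nrC : InfinitePlace.nrComplexPlaces KK = 1 := by
  have h1 := InfinitePlace.card_add_two_mul_card_eq_rank KK
  rw [finrank_KK] at h1
  have h2 := sign_discr KK
  rw [Int.sign_eq_neg_one_of_neg discr_neg] at h2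
  have : InfinitePlace.nrComplexPlaces KK ≤ 1 := by omega
  interval_cases h : InfinitePlace.nrComplexPlaces KK
  · simp at h2
  · rfl

lemma nrR : InfinitePlace.nrRealPlaces KK = 1 := by
  have h1 := InfinitePlace.card_add_two_mul_card_eq_rank KK
  rw [finrank_KK, nrC] at h1
  omega

lemma unit_rank : Units.rank KK = 1 := by
  unfold Units.rank
  rw [InfinitePlace.card_eq_nrRealPlaces_add_nrComplexPlaces, nrC, nrR]

lemma unit_gen : ∃ η : (𝓞 KK)ˣ, ∀ u : (𝓞 KK)ˣ, ∃ n : ℤ, u = η ^ n ∨ u = - η ^ n := by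
  have hr := unit_rank
  refine ⟨Units.fundSystem KK ⟨0, by omega⟩, fun u => ?_⟩
  obtain ⟨⟨ζ, e⟩, h, -⟩ := Units.exist_unique_eq_mul_prod KK u
  refine ⟨e ⟨0, by omega⟩, ?_⟩
  have h1 : ∏ i, Units.fundSystem KK i ^ e i = Units.fundSystem KK ⟨0, by omega⟩ ^ e ⟨0, by omega⟩ := by
    have : Unique (Fin (Units.rank KK)) := by rw [hr]; infer_instance
    rw [Fintype.prod_unique]
    congr! <;> (have := (default : Fin (Units.rank KK)).isLt; omega)
  simp only [h1] at h
  have := Units.torsion_eq_one_or_neg_one_of_odd_finrank (by rw [finrank_KK]; decide) ζ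
  rcases this with h2 | h2
  · left; rw [h, h2]; simp
  · right; rw [h, h2]; simp

end

section
open Polynomial NumberField Ideal

lemma norm_pho_lin (a b : ℤ) : Algebra.norm ℤ ((a : 𝓞 KK) + b * pho) = a ^ 3 + a ^ 2 * b + 4 * a * b ^ 2 + 2 * b ^ 3 := by
  have h := Algebra.coe_norm_int ((a : 𝓞 KK) + (b : 𝓞 KK) * pho)
  have h2 := norm_KK a b 0
  have h3 : (((a : 𝓞 KK) + b * pho : 𝓞 KK) : KK) = ((a : ℚ) : KK) + ((b : ℚ) : KK) * ph + ((0 : ℚ) : KK) * ph ^ 2 := by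
    simp [pho_coe]
  rw [h3, h2] at h
  have : ((Algebra.norm ℤ ((a : 𝓞 KK) + b * pho) : ℤ) : ℚ) = ((a ^ 3 + a ^ 2 * b + 4 * a * b ^ 2 + 2 * b ^ 3 : ℤ) : ℚ) := by
    rw [h]; push_cast; ring
  exact_mod_cast this

lemma norm_pho : Algebra.norm ℤ pho = 2 := by
  have := norm_pho_lin 0 1; simpa using this

lemma norm_pho_sub : Algebra.norm ℤ (pho - 1) = -2 := by
  have := norm_pho_lin (-1) 1
  norm_num at this
  rw [← this]; congr 1; ring

lemma span_eq_of_norm_two (x : 𝓞 KK) (hx : (Algebra.norm ℤ x).natAbs = 2) (I : Ideal (𝓞 KK))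
    (hI : I ≠ ⊤) (hxI : x ∈ I) : I = span {x} := by
  have h1 : (absNorm (span {x})) = 2 := by rw [absNorm_span_singleton, hx]
  have h2 : (span {x}).IsPrime := isPrime_of_irreducible_absNorm (by rw [h1]; exact Nat.prime_two)
  have h3 : (span {x}) ≠ ⊥ := by
    intro h; rw [h] at h1; simp at h1
  have h4 := h2.isMaximal h3
  exact (h4.eq_of_le hI ((span_singleton_le_iff_mem _).2 hxI)).symm

lemma pho_prime : Prime pho := by
  have h : (span {pho}).IsPrime := isPrime_of_irreducible_absNorm (by
    rw [absNorm_span_singleton, norm_pho]; exact Nat.prime_two)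
  exact (span_singleton_prime (by intro h; have := norm_pho; rw [h] at this; simp at this)).1 h

lemma pho_sub_prime : Prime (pho - 1) := by
  have h : (span {pho - 1}).IsPrime := isPrime_of_irreducible_absNorm (by
    rw [absNorm_span_singleton, norm_pho_sub]; exact Nat.prime_two)
  exact (span_singleton_prime (by intro h; have := norm_pho_sub; rw [h] at this; simp at this)).1 h

lemma two_fac : pho ^ 2 * (pho - 1) = 2 * (1 - 2 * pho) := by
  linear_combination pho_eq

lemma minkowski_lt : (4 / Real.pi) ^ InfinitePlace.nrComplexPlaces KK *
    ((Module.finrank ℚ KK).factorial / (Module.finrank ℚ KK) ^ (Module.finrank ℚ KK) *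
      √|discr KK|) < 5 := by
  rw [nrC, finrank_KK]
  have h1 : √|(discr KK : ℝ)| ≤ √212 := by
    apply Real.sqrt_le_sqrt
    exact_mod_cast abs_discr_le
  have h2 : √(212 : ℝ) ≤ 14.6 := by
    rw [Real.sqrt_le_left (by norm_num)]; norm_num
  have h3 : 4 / Real.pi ≤ 4 / 3 := by
    apply div_le_div_of_nonneg_left <;> linarith [Real.pi_gt_three]
  have h4 : 0 < 4 / Real.pi := by positivity
  have h5 : 0 ≤ √|(discr KK : ℝ)| := Real.sqrt_nonneg _
  norm_num [Nat.factorial]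
  nlinarith

instance pid_KK : IsPrincipalIdealRing (𝓞 KK) := by
  apply RingOfIntegers.isPrincipalIdealRing_of_isPrincipal_of_norm_le_of_isPrime
  intro I hI hle
  have hlt : absNorm (I : Ideal (𝓞 KK)) < 5 := by
    have := lt_of_le_of_lt hle minkowski_lt
    exact_mod_cast this
  have h0 : absNorm (I : Ideal (𝓞 KK)) ≠ 0 := absNorm_ne_zero_of_nonZeroDivisors I
  have h1 : absNorm (I : Ideal (𝓞 KK)) ≠ 1 := by
    rw [Ne, absNorm_eq_one_iff]; exact hI.ne_top
  have hmem := absNorm_mem (I : Ideal (𝓞 KK))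
  have htwo : (2 : 𝓞 KK) ∈ (I : Ideal (𝓞 KK)) → Submodule.IsPrincipal (I : Ideal (𝓞 KK)) := by
    intro h
    have h2 : pho ^ 2 * (pho - 1) ∈ (I : Ideal (𝓞 KK)) := by
      rw [two_fac]; exact Ideal.mul_mem_right _ _ h
    rcases hI.mem_or_mem h2 with h3 | h3
    · have := span_eq_of_norm_two pho (by rw [norm_pho]; rfl) _ hI.ne_top (hI.mem_of_pow_mem _ h3)
      rw [this]; exact ⟨⟨pho, rfl⟩⟩
    · have := span_eq_of_norm_two (pho - 1) (by rw [norm_pho_sub]; rfl) _ hI.ne_top h3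
      rw [this]; exact ⟨⟨_, rfl⟩⟩
  have hcases : absNorm (I : Ideal (𝓞 KK)) = 2 ∨ absNorm (I : Ideal (𝓞 KK)) = 3 ∨ absNorm (I : Ideal (𝓞 KK)) = 4 := by omega
  rcases hcases with h | h | h
  · rw [h] at hmem; exact htwo (by exact_mod_cast hmem)
  · exfalso
    have hc : Nat.card (𝓞 KK ⧸ (I : Ideal (𝓞 KK))) = 3 := by
      rw [← h, absNorm_apply]; rfl
    have : Fintype (𝓞 KK ⧸ (I : Ideal (𝓞 KK))) := @Fintype.ofFinite _ (Nat.finite_of_card_ne_zero (by rw [hc]; norm_num))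
    rw [Nat.card_eq_fintype_card] at hc
    let e := ZMod.ringEquivOfPrime (𝓞 KK ⧸ (I : Ideal (𝓞 KK))) Nat.prime_three hc
    let t : ZMod 3 := e.symm (Ideal.Quotient.mk _ pho)
    have ht : t ^ 3 = t ^ 2 - 4 * t + 2 := by
      have h4 : pho ^ 3 = pho ^ 2 - ((4 : ℕ) : 𝓞 KK) * pho + ((2 : ℕ) : 𝓞 KK) := by
        push_cast; exact pho_eq
      have := congrArg (fun z => e.symm (Ideal.Quotient.mk (I : Ideal (𝓞 KK)) z)) h4
      simp only [map_add, map_sub, map_mul, map_pow, map_natCast] at this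
      exact_mod_cast this
    revert ht
    generalize t = t
    revert t
    decide
  · rw [h] at hmem
    apply htwo
    have : (2 : 𝓞 KK) ^ 2 ∈ (I : Ideal (𝓞 KK)) := by
      have e : (2 : 𝓞 KK) ^ 2 = ((4 : ℕ) : 𝓞 KK) := by norm_num
      rw [e]; exact hmem
    exact hI.mem_of_pow_mem _ this

end

section
open Polynomial NumberField

lemma pho_sub_ne : pho - 1 ≠ 0 := pho_sub_prime.ne_zero

/-- The unit `2φ - 1`. -/
noncomputable def epsU : (𝓞 KK)ˣ where
  val := 2 * pho - 1
  inv := (2 * pho - 1) ^ 2 + (2 * pho - 1) + 15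
  val_inv := by linear_combination 8 * pho_eq
  inv_val := by linear_combination 8 * pho_eq

lemma epsU_val : (epsU : 𝓞 KK) = 2 * pho - 1 := rfl

lemma exists_w : ∃ w : 𝓞 KK, w * (1 - 2 * pho) = 1 ∧ pho ^ 2 * (pho - 1) * w = 2 := by
  refine ⟨-((2 * pho - 1) ^ 2 + (2 * pho - 1) + 15), by linear_combination 8 * pho_eq, ?_⟩
  rw [two_fac]; linear_combination 16 * pho_eq

/-- If `γ ^ 2 + 1` is even then `γ = 1 + φ (φ - 1) d`. -/
lemma gam_form (γ s : 𝓞 KK) (h : γ ^ 2 + 1 = 2 * s) : ∃ d, γ = 1 + pho * (pho - 1) * d := by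
  obtain ⟨w, hw, h2⟩ := exists_w
  have h3 : (γ - 1) ^ 2 = pho ^ 2 * (pho - 1) * w * (s - γ) := by
    rw [h2]; linear_combination h
  have h4 : pho ∣ γ - 1 := pho_prime.dvd_of_dvd_pow
    (n := 2) ⟨pho * (pho - 1) * w * (s - γ), by rw [h3]; ring⟩
  have h5 : pho - 1 ∣ γ - 1 := pho_sub_prime.dvd_of_dvd_pow
    (n := 2) ⟨pho ^ 2 * w * (s - γ), by rw [h3]; ring⟩
  have hc : IsCoprime pho (pho - 1) := ⟨1, -1, by ring⟩
  obtain ⟨d, hd⟩ := hc.mul_dvd h4 h5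
  exact ⟨d, by linear_combination hd⟩

lemma not_neg (γ δ : 𝓞 KK) : - γ ^ 2 ≠ 1 + 4 * δ := by
  intro h
  obtain ⟨d, rfl⟩ := gam_form γ (-2 * δ) (by linear_combination -h)
  obtain ⟨w, hw, h2⟩ := exists_w
  have h3 : pho ^ 2 * (pho - 1) * (w + w * pho * (pho - 1) * d + (pho - 1) * d ^ 2)
      = pho ^ 2 * (pho - 1) * (- pho ^ 2 * (pho - 1) * w ^ 2 * δ) := by
    linear_combination -h + (1 + pho * (pho - 1) * d + δ * (2 + pho ^ 2 * (pho - 1) * w)) * h2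
  have h4 := mul_left_cancel₀ (mul_ne_zero (pow_ne_zero 2 pho_prime.ne_zero) pho_sub_ne) h3
  have h5 : pho - 1 ∣ 1 := by
    have : pho - 1 ∣ w := ⟨- w * pho * d - d ^ 2 - pho ^ 2 * w ^ 2 * δ, by linear_combination h4⟩
    have t := this.mul_right (1 - 2 * pho)
    rw [hw] at t; exact t
  exact pho_sub_prime.not_isUnit (isUnit_of_dvd_one h5)

lemma not_eps (γ δ : 𝓞 KK) : (2 * pho - 1) * γ ^ 2 ≠ 1 + 4 * δ := by
  intro h
  obtain ⟨d, rfl⟩ := gam_form γ (pho * γ ^ 2 - 2 * δ) (by linear_combination -h)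
  obtain ⟨w, hw, h2⟩ := exists_w
  obtain ⟨k, hk⟩ : ∃ k, k = (1 - 2 * pho) * (w * pho * (pho - 1) * d + (pho - 1) * d ^ 2) := ⟨_, rfl⟩
  have hk2 : (1 + pho * (pho - 1) * d) ^ 2 = 1 + 2 * k := by
    rw [hk]
    linear_combination (-(pho * (pho - 1) * d)) * h2
      + (w * pho * (pho - 1) * d + (pho - 1) * d ^ 2) * two_fac
  have h3 : pho ^ 2 * (pho - 1) * ((pho - 1) * (w - w * pho * d - d ^ 2))
      = pho ^ 2 * (pho - 1) * ((pho - 1) * (pho ^ 2 * w ^ 2 * (δ - pho * k))) := by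
    rw [hk2] at h
    linear_combination ((pho - 1) - pho * (pho - 1) * d) * h2 - hk2 + h - (δ - pho * k) * (pho ^ 2 * (pho - 1) * w + 2) * h2
  have h4 := mul_left_cancel₀ (mul_ne_zero (pow_ne_zero 2 pho_prime.ne_zero) pho_sub_ne) h3
  have h5 := mul_left_cancel₀ pho_sub_ne h4
  -- reduce modulo `φ ^ 2`
  have hw2 : w = 1 + 2 * pho * w := by linear_combination hw
  have h6 : pho ^ 2 ∣ 1 - pho * d - d ^ 2 := by
    refine ⟨w ^ 2 * (δ - pho * k) - (pho - 1) * w * pho * w * (1 - pho * d), ?_⟩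
    linear_combination h5 - (1 - pho * d) * hw2 + (1 - pho * d) * pho * w * h2
  have h7 : pho ∣ d - 1 := by
    have : pho ∣ (d - 1) ^ 2 := by
      obtain ⟨r, hr⟩ := h6
      exact ⟨-pho * r - d + pho * (pho - 1) * w * (1 - d), by linear_combination -hr - (1 - d) * h2⟩
    exact pho_prime.dvd_of_dvd_pow this
  obtain ⟨r, hr⟩ := h7
  have hd : d = 1 + pho * r := by linear_combination hr
  have h8 : pho ^ 2 ∣ pho := by
    obtain ⟨q, hq⟩ := h6
    rw [hd] at hq
    refine ⟨-q - r - r ^ 2 - pho * (pho - 1) * w * r, ?_⟩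
    linear_combination -hq + pho * r * h2
  have h9 : pho ∣ 1 := by
    obtain ⟨q, hq⟩ := h8
    refine ⟨q, mul_left_cancel₀ pho_prime.ne_zero ?_⟩
    linear_combination hq
  exact pho_prime.not_isUnit (isUnit_of_dvd_one h9)

lemma not_neg_eps (γ δ : 𝓞 KK) : -(2 * pho - 1) * γ ^ 2 ≠ 1 + 4 * δ := by
  intro h
  obtain ⟨d, rfl⟩ := gam_form γ (pho * γ ^ 2 + 2 * δ + 1) (by linear_combination h)
  obtain ⟨w, hw, h2⟩ := exists_w
  obtain ⟨k, hk⟩ : ∃ k, k = (1 - 2 * pho) * (w * pho * (pho - 1) * d + (pho - 1) * d ^ 2) := ⟨_, rfl⟩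
  have hk2 : (1 + pho * (pho - 1) * d) ^ 2 = 1 + 2 * k := by
    rw [hk]
    linear_combination (-(pho * (pho - 1) * d)) * h2
      + (w * pho * (pho - 1) * d + (pho - 1) * d ^ 2) * two_fac
  have h3 : pho ^ 2 * (pho - 1) * (w * pho * (pho - 1) * d + (pho - 1) * d ^ 2 - w * pho)
      = pho ^ 2 * (pho - 1) * (pho ^ 2 * (pho - 1) * w ^ 2 * (δ + pho * k)) := by
    rw [hk2] at h
    linear_combination (pho * (pho - 1) * d - pho) * h2 + hk2 + h - (δ + pho * k) * (pho ^ 2 * (pho - 1) * w + 2) * h2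
  have h4 := mul_left_cancel₀ (mul_ne_zero (pow_ne_zero 2 pho_prime.ne_zero) pho_sub_ne) h3
  have h5 : pho ∣ d := by
    have h5 : pho ∣ (pho - 1) * d ^ 2 := ⟨w - w * (pho - 1) * d + pho * (pho - 1) * w ^ 2 * (δ + pho * k),
      by linear_combination h4⟩
    rcases pho_prime.dvd_or_dvd h5 with h6 | h6
    · exfalso
      have : pho ∣ 1 := by simpa using dvd_sub (dvd_refl pho) h6
      exact pho_prime.not_isUnit (isUnit_of_dvd_one this)
    · exact pho_prime.dvd_of_dvd_pow h6
  obtain ⟨r, rfl⟩ := h5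
  have h6 : w = pho * (w * (pho - 1) * r + (pho - 1) * r ^ 2 - (pho - 1) * w ^ 2 * (δ + pho * k)) := by
    apply mul_left_cancel₀ pho_prime.ne_zero
    linear_combination -h4
  have : pho ∣ 1 := by
    rw [← hw]; exact (Dvd.intro _ h6.symm).mul_right _
  exact pho_prime.not_isUnit (isUnit_of_dvd_one this)

lemma unit_sq_of_mod4 (u : (𝓞 KK)ˣ) (γ δ : 𝓞 KK) (h : (u : 𝓞 KK) * γ ^ 2 = 1 + 4 * δ) :
    ∃ v : (𝓞 KK)ˣ, u = v ^ 2 := by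
  obtain ⟨η, hη⟩ := unit_gen
  obtain ⟨k, hk⟩ := hη epsU
  obtain ⟨n, hn⟩ := hη u
  have hinv : ∀ m : ℤ, (η ^ m : (𝓞 KK)ˣ).val * (η ^ (-m) : (𝓞 KK)ˣ).val = 1 := by
    intro m
    rw [← Units.val_mul, ← zpow_add]; simp
  have hkodd : Odd k := by
    by_contra hke
    rw [Int.not_odd_iff_even] at hke
    obtain ⟨j, rfl⟩ := hke
    have h1 := hinv j
    rcases hk with hk | hk
    · apply not_eps (η ^ (-j) : (𝓞 KK)ˣ).val 0
      rw [← epsU_val, hk, zpow_add, Units.val_mul]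
      linear_combination ((η ^ j : (𝓞 KK)ˣ).val * (η ^ (-j) : (𝓞 KK)ˣ).val + 1) * h1
    · apply not_neg_eps (η ^ (-j) : (𝓞 KK)ˣ).val 0
      rw [← epsU_val, hk, zpow_add, Units.val_neg, Units.val_mul]
      linear_combination ((η ^ j : (𝓞 KK)ˣ).val * (η ^ (-j) : (𝓞 KK)ˣ).val + 1) * h1
  rcases Int.even_or_odd n with hne | hno
  · obtain ⟨j, rfl⟩ := hne
    rcases hn with hn | hn
    · exact ⟨η ^ j, by rw [hn, zpow_add, sq]⟩
    · exfalso
      apply not_neg ((η ^ j : (𝓞 KK)ˣ).val * γ) δ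
      rw [← h, hn, zpow_add, Units.val_neg, Units.val_mul]; ring
  · exfalso
    obtain ⟨j, hj⟩ : ∃ j, n = k + (j + j) := by
      obtain ⟨a, ha⟩ := hkodd
      obtain ⟨b, hb⟩ := hno
      exact ⟨b - a, by omega⟩
    have h2 : (η ^ n : (𝓞 KK)ˣ).val = (η ^ k : (𝓞 KK)ˣ).val * (η ^ j : (𝓞 KK)ˣ).val ^ 2 := by
      rw [hj, zpow_add, zpow_add, Units.val_mul, Units.val_mul]; ring
    have h3 : (epsU : 𝓞 KK) = (η ^ k : (𝓞 KK)ˣ).val ∨ (epsU : 𝓞 KK) = - (η ^ k : (𝓞 KK)ˣ).val := by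
      rcases hk with hk | hk
      · left; rw [hk]
      · right; rw [hk, Units.val_neg]
    have h4 : (u : 𝓞 KK) = (η ^ n : (𝓞 KK)ˣ).val ∨ (u : 𝓞 KK) = - (η ^ n : (𝓞 KK)ˣ).val := by
      rcases hn with hk | hk
      · left; rw [hk]
      · right; rw [hk, Units.val_neg]
    rw [epsU_val] at h3
    rw [h2] at h4
    rcases h3 with h3 | h3 <;> rcases h4 with h4 | h4
    · apply not_eps ((η ^ j : (𝓞 KK)ˣ).val * γ) δ
      rw [← h, h4, h3]; ring
    · apply not_neg_eps ((η ^ j : (𝓞 KK)ˣ).val * γ) δ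
      rw [← h, h4, h3]; ring
    · apply not_neg_eps ((η ^ j : (𝓞 KK)ˣ).val * γ) δ
      rw [← h, h4, h3]; ring
    · apply not_eps ((η ^ j : (𝓞 KK)ˣ).val * γ) δ
      rw [← h, h4, h3]; ring

lemma descent_sq (X Y W : ℤ) (hX : X % 4 = 1) (hW : 4 ∣ W)
    (hc : Y ^ 2 = X ^ 3 + X ^ 2 * W - 4 * X * W ^ 2 - 8 * W ^ 3)
    (hcop : IsCoprime (Y ^ 2) (3 * X ^ 2 + 2 * X * W - 4 * W ^ 2)) :
    ∃ g : KK, (X : KK) - (ph ^ 2 + 2) * W = g ^ 2 := by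
  obtain ⟨e, he⟩ : ∃ e : 𝓞 KK, e = pho ^ 2 + 2 := ⟨_, rfl⟩
  have hee : e ^ 3 + e ^ 2 - 4 * e - 8 = 0 := by
    rw [he]; linear_combination (pho ^ 3 + pho ^ 2 + 4 * pho + 2) * pho_eq
  have hprod : ((X : 𝓞 KK) - e * W) * (X ^ 2 + (e + 1) * X * W + (e ^ 2 + e - 4) * W ^ 2) = (Y : 𝓞 KK) ^ 2 := by
    have : (Y : 𝓞 KK) ^ 2 = X ^ 3 + X ^ 2 * W - 4 * X * W ^ 2 - 8 * W ^ 3 := by exact_mod_cast congrArg (Int.cast : ℤ → 𝓞 KK) hc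
    rw [this]; linear_combination -(W : 𝓞 KK) ^ 3 * hee
  have hco : IsCoprime ((X : 𝓞 KK) - e * W) (X ^ 2 + (e + 1) * X * W + (e ^ 2 + e - 4) * W ^ 2) := by
    obtain ⟨a, b, hab⟩ := hcop
    have hab' : (a : 𝓞 KK) * (Y : 𝓞 KK) ^ 2 + b * (3 * (X : 𝓞 KK) ^ 2 + 2 * X * W - 4 * W ^ 2) = 1 := by
      exact_mod_cast congrArg (Int.cast : ℤ → 𝓞 KK) hab
    -- F' = β + α * (2 X + (e + 1) W)
    refine ⟨a * (X ^ 2 + (e + 1) * X * W + (e ^ 2 + e - 4) * W ^ 2) + b * (2 * X + (e + 1) * W), b, ?_⟩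
    rw [← hprod] at hab'
    linear_combination hab'
  obtain ⟨γ, u, hu⟩ := exists_associated_pow_of_mul_eq_pow' hco hprod
  obtain ⟨x', hx'⟩ : ∃ x', X = 1 + 4 * x' := ⟨X / 4, by omega⟩
  obtain ⟨w', hw'⟩ := hW
  have h4 : (u : 𝓞 KK) * γ ^ 2 = 1 + 4 * ((x' : 𝓞 KK) - e * w') := by
    rw [mul_comm, hu, hx', hw']; push_cast; ring
  obtain ⟨v, hv⟩ := unit_sq_of_mod4 u γ _ h4
  refine ⟨((γ * v : 𝓞 KK) : KK), ?_⟩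
  have h5 : (X : 𝓞 KK) - (pho ^ 2 + 2) * W = (γ * v) ^ 2 := by
    rw [← he, ← hu, hv, Units.val_pow_eq_pow_val]; ring
  have := congrArg (algebraMap (𝓞 KK) KK) h5
  rw [map_pow] at this
  refine Eq.trans ?_ this
  rw [map_sub, map_mul, map_add, map_pow, map_intCast, map_intCast]
  rfl

end

section
open Polynomial NumberField

/-- Output of the two-descent: rational halving data. -/
lemma halving (X Y Z : ℤ) (hX : X % 4 = 1) (hZ : 2 ∣ Z) (hZ0 : Z ≠ 0)
    (hc : Y ^ 2 = X ^ 3 + X ^ 2 * Z ^ 2 - 4 * X * Z ^ 4 - 8 * Z ^ 6)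
    (hcop : IsCoprime (Y ^ 2) (3 * X ^ 2 + 2 * X * Z ^ 2 - 4 * Z ^ 4)) (x y : ℚ)
    (hx : x = X / Z ^ 2) (hy : y = Y / Z ^ 3) :
    ∃ s t : ℚ, s ^ 2 - 2 * t = 3 * x + 1 ∧ t ^ 2 - 2 * s * y = 3 * x ^ 2 + 2 * x - 4 := by
  obtain ⟨g, hg⟩ := descent_sq X Y (Z ^ 2) hX
    (by obtain ⟨k, rfl⟩ := hZ; exact ⟨k ^ 2, by ring⟩) (by rw [hc]; ring)
    (by convert hcop using 1; ring)
  have hZq : (Z : ℚ) ≠ 0 := by exact_mod_cast hZ0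
  have hZK : (Z : KK) ≠ 0 := by exact_mod_cast hZ0
  have hxy : y ^ 2 = x ^ 3 + x ^ 2 - 4 * x - 8 := by
    have : (Y : ℚ) ^ 2 = X ^ 3 + X ^ 2 * Z ^ 2 - 4 * X * Z ^ 4 - 8 * Z ^ 6 := by exact_mod_cast hc
    rw [hx, hy]; field_simp; linear_combination this
  obtain ⟨a, b, c, habc⟩ := BK_sum (g / Z)
  have h1 : (x : KK) - (ph ^ 2 + 2) = (a + b * ph + c * ph ^ 2) ^ 2 := by
    rw [← habc, hx, div_pow, ← hg]
    push_cast
    field_simp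
  have h2 := BK_indep (a ^ 2 + 4 * b * c + 2 * c ^ 2 - x + 2) (2 * a * b - 8 * b * c - 2 * c ^ 2)
    (b ^ 2 + 2 * a * c + 2 * b * c - 3 * c ^ 2 + 1) (by
      push_cast
      linear_combination -h1 - (2 * b * c + c ^ 2 * ph + c ^ 2) * ph_eq)
  obtain ⟨e0, e1, e2⟩ := h2
  obtain ⟨s1, hs1⟩ : ∃ s1, s1 = 3 * a + b - 7 * c := ⟨_, rfl⟩
  obtain ⟨s2, hs2⟩ : ∃ s2, s2 = a * (a - 4 * c) - 2 * b * c + a * (a + b - 3 * c) - c * (2 * b + 2 * c)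
    + (a - 4 * c) * (a + b - 3 * c) - (- 4 * b - 2 * c) * (b + c) := ⟨_, rfl⟩
  obtain ⟨s3, hs3⟩ : ∃ s3, s3 = a * ((a - 4 * c) * (a + b - 3 * c) - (- 4 * b - 2 * c) * (b + c))
    - 2 * c * (b * (a + b - 3 * c) - (- 4 * b - 2 * c) * c)
    + (2 * b + 2 * c) * (b * (b + c) - (a - 4 * c) * c) := ⟨_, rfl⟩
  obtain ⟨A, hA⟩ : ∃ A, A = a ^ 2 + 4 * b * c + 2 * c ^ 2 := ⟨_, rfl⟩
  obtain ⟨B, hB⟩ : ∃ B, B = 2 * a * b - 8 * b * c - 2 * c ^ 2 := ⟨_, rfl⟩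
  obtain ⟨C, hC⟩ : ∃ C, C = b ^ 2 + 2 * a * c + 2 * b * c - 3 * c ^ 2 := ⟨_, rfl⟩
  have f1 : s1 ^ 2 - 2 * s2 = 3 * A + B - 7 * C := by rw [hs1, hs2, hA, hB, hC]; ring
  have f2 : s2 ^ 2 - 2 * s1 * s3 = A * (A - 4 * C) - 2 * B * C + A * (A + B - 3 * C) - C * (2 * B + 2 * C)
    + (A - 4 * C) * (A + B - 3 * C) - (- 4 * B - 2 * C) * (B + C) := by
    rw [hs1, hs2, hs3, hA, hB, hC]; ring
  have f3 : s3 ^ 2 = A * ((A - 4 * C) * (A + B - 3 * C) - (- 4 * B - 2 * C) * (B + C))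
    - 2 * C * (B * (A + B - 3 * C) - (- 4 * B - 2 * C) * C)
    + (2 * B + 2 * C) * (B * (B + C) - (A - 4 * C) * C) := by
    rw [hs3, hA, hB, hC]; ring
  have gA : A = x - 2 := by rw [hA]; linear_combination e0
  have gB : B = 0 := by rw [hB]; linear_combination e1
  have gC : C = -1 := by rw [hC]; linear_combination e2
  rw [gA, gB, gC] at f1 f2 f3
  have f4 : s3 ^ 2 = y ^ 2 := by rw [f3, hxy]; ring
  rcases sq_eq_sq_iff_eq_or_eq_neg.1 f4 with h | h
  · exact ⟨s1, s2, by linear_combination f1, by rw [← h]; linear_combination f2⟩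
  · refine ⟨-s1, s2, by linear_combination f1, ?_⟩
    have : y = -s3 := by linear_combination h
    rw [this]; linear_combination f2

end

section
/-- The elliptic curve `y² = x³ + x² - 4x - 8`. -/
def EW : WeierstrassCurve.Affine ℚ := ⟨0, 1, 0, -4, -8⟩

/-- The Mordell-Weil group. -/
abbrev EP := EW.Point

lemma EW_nons {x y : ℚ} (h : y ^ 2 = x ^ 3 + x ^ 2 - 4 * x - 8) : EW.Nonsingular x y := by
  rw [← WeierstrassCurve.Affine.equation_iff_nonsingular_of_Δ_ne_zero]
  · rw [WeierstrassCurve.Affine.equation_iff]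
    simp only [EW]; linear_combination h
  · simp only [EW, WeierstrassCurve.Δ, WeierstrassCurve.b₂, WeierstrassCurve.b₄, WeierstrassCurve.b₆,
      WeierstrassCurve.b₈]
    norm_num

/-- `P` is the affine point with coordinates `(x, y)`. -/
def At (P : EP) (x y : ℚ) : Prop := ∃ h, P = .some x y h

lemma At.eq {P : EP} {x y : ℚ} (h : At P x y) : y ^ 2 = x ^ 3 + x ^ 2 - 4 * x - 8 := by
  obtain ⟨h, -⟩ := h
  have := h.1
  rw [WeierstrassCurve.Affine.equation_iff] at this
  simp only [EW] at this
  linear_combination this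

lemma at_mk {x y : ℚ} (h : y ^ 2 = x ^ 3 + x ^ 2 - 4 * x - 8) : ∃ P, At P x y :=
  ⟨.some x y (EW_nons h), EW_nons h, rfl⟩

lemma At.inj {P : EP} {x y x' y' : ℚ} (h : At P x y) (h' : At P x' y') : x = x' ∧ y = y' := by
  obtain ⟨h1, rfl⟩ := h
  obtain ⟨h2, h3⟩ := h'
  simpa using h3

lemma At.ne_zero {P : EP} {x y : ℚ} (h : At P x y) : P ≠ 0 := by
  obtain ⟨h1, rfl⟩ := h
  exact WeierstrassCurve.Affine.Point.some_ne_zero h1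

lemma zero_or_at (P : EP) : P = 0 ∨ ∃ x y, At P x y := by
  rcases P with _ | ⟨x, y, h⟩
  · left; rfl
  · right; exact ⟨x, y, h, rfl⟩

lemma At.unique {P Q : EP} {x y : ℚ} (h : At P x y) (h' : At Q x y) : P = Q := by
  obtain ⟨h1, rfl⟩ := h
  obtain ⟨h2, rfl⟩ := h'
  rfl

lemma At.neg {P : EP} {x y : ℚ} (h : At P x y) : At (-P) x (-y) := by
  obtain ⟨h1, rfl⟩ := h
  rw [WeierstrassCurve.Affine.Point.neg_some]
  have e : EW.negY x y = -y := by simp [WeierstrassCurve.Affine.negY, EW]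
  refine ⟨by rw [← e]; exact (WeierstrassCurve.Affine.nonsingular_neg x y).2 h1, ?_⟩
  congr 1

lemma At.eq_or_neg {P Q : EP} {x y y' : ℚ} (h : At P x y) (h' : At Q x y') : Q = P ∨ Q = -P := by
  have : y' ^ 2 = y ^ 2 := by rw [h.eq, h'.eq]
  rcases sq_eq_sq_iff_eq_or_eq_neg.1 this with rfl | rfl
  · left; exact h'.unique h
  · right; exact h'.unique h.neg

lemma At.add {P Q : EP} {x1 y1 x2 y2 l : ℚ} (h1 : At P x1 y1) (h2 : At Q x2 y2) (hne : x1 ≠ x2)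
    (hl : l * (x1 - x2) = y1 - y2) :
    At (P + Q) (l ^ 2 - 1 - x1 - x2) (-(l * (l ^ 2 - 1 - x1 - x2 - x1) + y1)) := by
  obtain ⟨h1, rfl⟩ := h1
  obtain ⟨h2, rfl⟩ := h2
  have hl' : EW.slope x1 x2 y1 y2 = l := by
    rw [WeierstrassCurve.Affine.slope_of_X_ne hne, eq_comm, eq_div_iff (sub_ne_zero.2 hne), hl]
  rw [WeierstrassCurve.Affine.Point.add_some (fun h => hne h.1)]
  have e1 : EW.addX x1 x2 (EW.slope x1 x2 y1 y2) = l ^ 2 - 1 - x1 - x2 := by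
    rw [hl']; simp [WeierstrassCurve.Affine.addX, EW]
  have e2 : EW.addY x1 x2 y1 (EW.slope x1 x2 y1 y2) = -(l * (l ^ 2 - 1 - x1 - x2 - x1) + y1) := by
    rw [hl']; simp [WeierstrassCurve.Affine.addX, WeierstrassCurve.Affine.addY,
      WeierstrassCurve.Affine.negAddY, WeierstrassCurve.Affine.negY, EW]
  have h3 := WeierstrassCurve.Affine.nonsingular_add h1 h2 (fun h => hne h.1)
  refine ⟨by rw [← e2, ← e1]; exact h3, ?_⟩
  congr 1

lemma At.dbl {P : EP} {x y l : ℚ} (h : At P x y) (hy : y ≠ 0)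
    (hl : l * (2 * y) = 3 * x ^ 2 + 2 * x - 4) :
    At (P + P) (l ^ 2 - 1 - x - x) (-(l * (l ^ 2 - 1 - x - x - x) + y)) := by
  obtain ⟨h1, rfl⟩ := h
  have hn : y ≠ EW.negY x y := by
    simp only [WeierstrassCurve.Affine.negY, EW]; intro h; apply hy; linarith
  have hl' : EW.slope x x y y = l := by
    rw [WeierstrassCurve.Affine.slope_of_Y_ne rfl hn, eq_comm, eq_div_iff (sub_ne_zero.2 hn)]
    simp only [WeierstrassCurve.Affine.negY, EW]; linear_combination hl
  rw [WeierstrassCurve.Affine.Point.add_some (fun h => hn h.2)]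
  have e1 : EW.addX x x (EW.slope x x y y) = l ^ 2 - 1 - x - x := by
    rw [hl']; simp [WeierstrassCurve.Affine.addX, EW]
  have e2 : EW.addY x x y (EW.slope x x y y) = -(l * (l ^ 2 - 1 - x - x - x) + y) := by
    rw [hl']; simp [WeierstrassCurve.Affine.addX, WeierstrassCurve.Affine.addY,
      WeierstrassCurve.Affine.negAddY, WeierstrassCurve.Affine.negY, EW]
  have h3 := WeierstrassCurve.Affine.nonsingular_add h1 h1 (fun h => hn h.2)
  refine ⟨by rw [← e2, ← e1]; exact h3, ?_⟩
  congr 1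

end

section
/-- Lowest terms representation of a rational point. -/
structure LRep (x y : ℚ) (X Y Z : ℤ) : Prop where
  zpos : 0 < Z
  cop : IsCoprime X Z
  hx : x = X / Z ^ 2
  hy : y = Y / Z ^ 3
  eq : Y ^ 2 = X ^ 3 + X ^ 2 * Z ^ 2 - 4 * X * Z ^ 4 - 8 * Z ^ 6

lemma int_of_sq {q : ℚ} {n : ℤ} (h : q ^ 2 = n) : ∃ m : ℤ, q = m := by
  have h1 : IsIntegral ℤ (q ^ 2) := by rw [h]; exact isIntegral_algebraMap (R := ℤ) (A := ℚ) (x := n)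
  have h2 : IsIntegral ℤ q := IsIntegral.of_pow (by norm_num) h1
  obtain ⟨m, hm⟩ := IsIntegrallyClosed.isIntegral_iff.1 h2
  exact ⟨m, by rw [← hm]; rfl⟩

lemma sq_of_cop {a b c : ℤ} (hab : IsCoprime a b) (h : a * b = c ^ 2) (ha : 0 < a) : ∃ d, 0 < d ∧ a = d ^ 2 := by
  obtain ⟨d, hd | hd⟩ := Int.sq_of_isCoprime hab h
  · refine ⟨|d|, ?_, by rw [hd, sq_abs]⟩
    apply abs_pos.2; rintro rfl; simp at hd; omega
  · nlinarith [sq_nonneg d]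

lemma exists_rep {x y : ℚ} (h : y ^ 2 = x ^ 3 + x ^ 2 - 4 * x - 8) : ∃ X Y Z, LRep x y X Y Z := by
  obtain ⟨X, hX⟩ : ∃ X, X = x.num := ⟨_, rfl⟩
  obtain ⟨W, hW⟩ : ∃ W : ℤ, W = x.den := ⟨_, rfl⟩
  have hWpos : 0 < W := by rw [hW]; exact_mod_cast x.den_pos
  have hcop : IsCoprime X W := by
    rw [hX, hW, Int.isCoprime_iff_gcd_eq_one]; exact x.reduced
  have hWq : (W : ℚ) ≠ 0 := by exact_mod_cast hWpos.ne'
  have hx : x = X / W := by rw [hX, hW]; exact_mod_cast (Rat.num_div_den x).symm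
  obtain ⟨N, hN⟩ : ∃ N, N = X ^ 3 + X ^ 2 * W - 4 * X * W ^ 2 - 8 * W ^ 3 := ⟨_, rfl⟩
  have h1 : (y * W ^ 2) ^ 2 = ((W * N : ℤ) : ℚ) := by
    rw [mul_pow, h, hN, hx]; push_cast; field_simp
  obtain ⟨M, hM⟩ := int_of_sq h1
  have h2 : W * N = M ^ 2 := by rw [hM] at h1; exact_mod_cast h1.symm
  have hWN : IsCoprime W N := by
    have : N = X ^ 3 + W * (X ^ 2 - 4 * X * W - 8 * W ^ 2) := by rw [hN]; ring
    rw [this]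
    exact (hcop.pow_left.symm).add_mul_left_right _
  obtain ⟨Z, hZ0, hZ⟩ := sq_of_cop hWN h2 hWpos
  have hZM : Z ∣ M := by
    rw [← Int.pow_dvd_pow_iff (n := 2) (by norm_num), ← hZ, ← h2]; exact dvd_mul_right _ _
  obtain ⟨Y, rfl⟩ := hZM
  have hZq : (Z : ℚ) ≠ 0 := by exact_mod_cast hZ0.ne'
  refine ⟨X, Y, Z, hZ0, ?_, by rw [hx, hZ]; push_cast; rfl, ?_, ?_⟩
  · rw [hZ] at hcop; exact (IsCoprime.pow_right_iff (by norm_num)).1 hcop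
  · rw [hZ] at hM; push_cast at hM
    field_simp
    apply mul_right_cancel₀ hZq
    linear_combination hM
  · have : Z ^ 2 * Y ^ 2 = Z ^ 2 * N := by rw [← hZ] ; linear_combination -h2 + Y ^ 2 * hZ
    have := mul_left_cancel₀ (pow_ne_zero 2 hZ0.ne') this
    rw [this, hN, hZ]; ring

namespace LRep
variable {x y : ℚ} {X Y Z : ℤ}

lemma num_den (h : LRep x y X Y Z) : x.num = X ∧ (x.den : ℤ) = Z ^ 2 := by
  have h1 : x = (X : ℚ) / ((Z ^ 2 : ℤ) : ℚ) := by rw [h.hx]; push_cast; rfl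
  have hc : IsCoprime X (Z ^ 2) := h.cop.pow_right
  have hp : (0 : ℤ) < Z ^ 2 := pow_pos h.zpos 2
  rw [Int.isCoprime_iff_gcd_eq_one] at hc
  exact ⟨by rw [h1]; exact Rat.num_div_eq_of_coprime hp hc, by rw [h1]; exact Rat.den_div_eq_of_coprime hp hc⟩

lemma zq (h : LRep x y X Y Z) : (Z : ℚ) ≠ 0 := by exact_mod_cast h.zpos.ne'

lemma not_dvd (h : LRep x y X Y Z) {p : ℤ} (hp : Prime p) (hX : p ∣ X) (hZ : p ∣ Z) : False :=
  hp.not_isUnit (h.cop.isUnit_of_dvd' hX hZ)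

lemma neg (h : LRep x y X Y Z) : LRep x (-y) X (-Y) Z :=
  ⟨h.zpos, h.cop, h.hx, by rw [h.hy]; push_cast; ring, by rw [neg_sq, h.eq]⟩

lemma X_odd (h : LRep x y X Y Z) : X % 2 = 1 := by
  by_contra hX
  have hX : X % 2 = 0 := by omega
  obtain ⟨k, hk⟩ : ∃ k, X = 2 * k := ⟨X / 2, by omega⟩
  have hZ : Z % 2 = 1 := by
    by_contra hZ
    exact h.not_dvd Int.prime_two (Int.dvd_of_emod_eq_zero hX) (Int.dvd_of_emod_eq_zero (by omega))
  have heq := h.eq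
  obtain ⟨m, hm⟩ : ∃ m, Y = 2 * m := by
    have : 2 ∣ Y ^ 2 := by rw [heq, hk]; exact ⟨4 * k ^ 3 + 2 * k ^ 2 * Z ^ 2 - 4 * k * Z ^ 4 - 4 * Z ^ 6, by ring⟩
    exact Int.prime_two.dvd_of_dvd_pow this
  have h2 : m ^ 2 = 2 * k ^ 3 + k ^ 2 * Z ^ 2 - 2 * k * Z ^ 4 - 2 * Z ^ 6 := by
    rw [hk, hm] at heq; linarith
  have h3 := congrArg (Int.cast : ℤ → ZMod 8) h2
  push_cast at h3
  have hz : (Z : ZMod 8) ^ 2 = 1 := by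
    obtain ⟨z, rfl⟩ : ∃ z, Z = 2 * z + 1 := ⟨Z / 2, by omega⟩
    push_cast
    generalize (z : ZMod 8) = z
    revert z; decide
  have h4 : (Z : ZMod 8) ^ 4 = 1 := by rw [show 4 = 2 * 2 by rfl, pow_mul, hz, one_pow]
  have h6 : (Z : ZMod 8) ^ 6 = 1 := by rw [show 6 = 2 * 3 by rfl, pow_mul, hz, one_pow]
  rw [hz, h4, h6] at h3
  revert h3
  generalize (m : ZMod 8) = m
  generalize (k : ZMod 8) = k
  revert m k; decide

lemma X_gt (h : LRep x y X Y Z) : 11 * Z ^ 2 < 5 * X := by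
  have h1 := h.eq
  have h0 := pow_pos h.zpos 2
  generalize hW : Z ^ 2 = W at *
  have h4 : Z ^ 4 = W ^ 2 := by rw [← hW]; ring
  have h6 : Z ^ 6 = W ^ 3 := by rw [← hW]; ring
  rw [h4, h6] at h1
  by_contra hc
  push Not at hc
  have e : 125 * (X ^ 3 + X ^ 2 * W - 4 * X * W ^ 2 - 8 * W ^ 3) =
     (5 * X - 11 * W) * (25 * X ^ 2 + 80 * X * W + 76 * W ^ 2) - 164 * W ^ 3 := by ring
  have h5 : 0 ≤ 25 * X ^ 2 + 80 * X * W + 76 * W ^ 2 := by nlinarith [sq_nonneg (5 * X + 8 * W)]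
  have h7 := mul_nonneg (sub_nonneg.2 hc) h5
  have h8 := pow_pos h0 3
  nlinarith [sq_nonneg Y]

lemma X_pos (h : LRep x y X Y Z) : 0 < X := by
  have := h.X_gt
  have := pow_pos h.zpos 2
  omega

lemma X_ge (h : LRep x y X Y Z) : 3 ≤ X := by
  have := h.X_gt
  have := pow_pos h.zpos 2
  omega

lemma mod3 (h : LRep x y X Y Z) : (X + Z ^ 2) % 3 = 1 ∧ Y ≠ 0 := by
  have h3 := congrArg (Int.cast : ℤ → ZMod 3) h.eq
  push_cast at h3
  have key : ∀ a b c : ZMod 3, b ^ 2 = a ^ 3 + a ^ 2 * c ^ 2 - 4 * a * c ^ 4 - 8 * c ^ 6 →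
    (a = 0 ∧ c = 0) ∨ (a + c ^ 2 = 1 ∧ b ≠ 0) := by decide
  rcases key _ _ _ h3 with ⟨ha, hc⟩ | ⟨ha, hb⟩
  · exact (h.not_dvd Int.prime_three ((ZMod.intCast_zmod_eq_zero_iff_dvd _ 3).1 ha) ((ZMod.intCast_zmod_eq_zero_iff_dvd _ 3).1 hc)).elim
  · constructor
    · have : (((X + Z ^ 2 : ℤ)) : ZMod 3) = ((1 : ℤ) : ZMod 3) := by push_cast; exact ha
      rw [ZMod.intCast_eq_intCast_iff] at this
      exact this
    · rintro rfl; simp at hb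

lemma y_ne (h : LRep x y X Y Z) : y ≠ 0 := by
  rw [h.hy]
  have : (Y : ℚ) ≠ 0 := by exact_mod_cast h.mod3.2
  exact div_ne_zero this (pow_ne_zero _ h.zq)

lemma even_facts (h : LRep x y X Y Z) (hZ : 2 ∣ Z) : X % 4 = 1 ∧ Y % 2 = 1 := by
  have hX := h.X_odd
  have heq := h.eq
  obtain ⟨z, rfl⟩ := hZ
  obtain ⟨k, rfl⟩ : ∃ k, X = 2 * k + 1 := ⟨X / 2, by omega⟩
  have hY : Y % 2 = 1 := by
    by_contra hY
    obtain ⟨m, rfl⟩ : ∃ m, Y = 2 * m := ⟨Y / 2, by omega⟩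
    ring_nf at heq
    omega
  refine ⟨?_, hY⟩
  obtain ⟨m, rfl⟩ : ∃ m, Y = 2 * m + 1 := ⟨Y / 2, by omega⟩
  ring_nf at heq
  omega

end LRep

end

section
namespace LRep
variable {x y : ℚ} {X Y Z : ℤ}

lemma bad_prime (h : LRep x y X Y Z) {p : ℤ} (hp : Prime p) (hp2 : ¬ p ∣ 2) (hY : p ∣ Y)
    (hD : p ∣ 3 * X ^ 2 + 2 * X * Z ^ 2 - 4 * Z ^ 4) : False := by
  have heq := h.eq
  have hZ : ¬ p ∣ Z := by
    intro hZ
    refine h.not_dvd hp (hp.dvd_of_dvd_pow (n := 3) ?_) hZ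
    have e : X ^ 3 = Y * Y - Z * (X ^ 2 * Z - 4 * X * Z ^ 3 - 8 * Z ^ 5) := by linear_combination -heq
    rw [e]
    exact dvd_sub (hY.mul_right _) (hZ.mul_right _)
  have h1 : p ∣ 13 * X + 34 * Z ^ 2 := by
    have e : 2 * (Z ^ 4 * (13 * X + 34 * Z ^ 2)) =
      (3 * X + Z ^ 2) * (3 * X ^ 2 + 2 * X * Z ^ 2 - 4 * Z ^ 4) - Y * (9 * Y) := by
      linear_combination 9 * heq
    have : p ∣ 2 * (Z ^ 4 * (13 * X + 34 * Z ^ 2)) := by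
      rw [e]; exact dvd_sub (hD.mul_left _) (hY.mul_right _)
    rcases hp.dvd_or_dvd this with h | h
    · exact (hp2 h).elim
    rcases hp.dvd_or_dvd h with h | h
    · exact (hZ (hp.dvd_of_dvd_pow h)).elim
    · exact h
  have h2 : p ∣ 2 ^ 2 * (3 ^ 2 * (53 * Z ^ 4)) := by
    have e : 2 ^ 2 * (3 ^ 2 * (53 * Z ^ 4)) = 169 * (3 * X ^ 2 + 2 * X * Z ^ 2 - 4 * Z ^ 4) -
      (13 * X + 34 * Z ^ 2) * (39 * X - 76 * Z ^ 2) := by ring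
    rw [e]; exact dvd_sub (hD.mul_left _) (h1.mul_right _)
  have h53 : p ∣ 53 := by
    rcases hp.dvd_or_dvd h2 with h' | h'
    · exact (hp2 (hp.dvd_of_dvd_pow h')).elim
    rcases hp.dvd_or_dvd h' with h' | h'
    · have h3 : p ∣ 3 := hp.dvd_of_dvd_pow h'
      have ha : Associated p 3 := hp.associated_of_dvd Int.prime_three h3
      have h4 : (3 : ℤ) ∣ 13 * X + 34 * Z ^ 2 := ha.symm.dvd.trans h1
      have := h.mod3.1
      omega
    rcases hp.dvd_or_dvd h' with h' | h'
    · exact h'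
    · exact (hZ (hp.dvd_of_dvd_pow h')).elim
  have p53 : Prime (53 : ℤ) := Int.prime_iff_natAbs_prime.2 (by norm_num)
  have ha : Associated p 53 := hp.associated_of_dvd p53 h53
  obtain ⟨k, hk⟩ := ha.symm.dvd.trans h1
  obtain ⟨m, hm⟩ := ha.symm.dvd.trans hY
  apply hZ
  refine h53.trans ?_
  have : (53 : ℤ) ∣ 356 * Z ^ 6 := by
    refine ⟨53 * k ^ 3 - 89 * k ^ 2 * Z ^ 2 + 36 * k * Z ^ 4 - 2197 * m ^ 2, ?_⟩
    have e : 13 * X = 53 * k - 34 * Z ^ 2 := by linarith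
    have e2 : 2197 * Y ^ 2 = (13 * X) ^ 3 + 13 * (13 * X) ^ 2 * Z ^ 2 - 4 * 169 * (13 * X) * Z ^ 4 - 8 * 2197 * Z ^ 6 := by
      rw [heq]; ring
    rw [e, hm] at e2
    linarith
  rcases p53.dvd_or_dvd this with h | h
  · norm_num at h
  · exact p53.dvd_of_dvd_pow h

lemma even_coprime (h : LRep x y X Y Z) (hZ : 2 ∣ Z) :
    IsCoprime (Y ^ 2) (3 * X ^ 2 + 2 * X * Z ^ 2 - 4 * Z ^ 4) := by
  apply IsCoprime.pow_left
  refine isCoprime_of_prime_dvd ?_ ?_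
  · rintro ⟨h1, -⟩; exact h.mod3.2 h1
  · intro p hp h1 h2
    refine h.bad_prime hp ?_ h1 h2
    intro h3
    have := hp.associated_of_dvd Int.prime_two h3
    have h4 := this.symm.dvd.trans h1
    have := (h.even_facts hZ).2
    omega

/-- numerator of the duplication formula -/
lemma dbl_rep (h : LRep x y X Y Z) {P : EP} (hP : At P x y) :
    ∃ x' y' X' Y' Z', At (P + P) x' y' ∧ LRep x' y' X' Y' Z' ∧ 2 ∣ Z' ∧ X ^ 4 ≤ X' := by
  have hy := h.y_ne
  have hd := hP.dbl hy (l := (3 * x ^ 2 + 2 * x - 4) / (2 * y)) (by field_simp)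
  obtain ⟨X', Y', Z', h'⟩ := exists_rep hd.eq
  refine ⟨_, _, X', Y', Z', hd, h', ?_⟩
  obtain ⟨A, hA⟩ : ∃ A, A = X ^ 4 + 8 * X ^ 2 * Z ^ 4 + 64 * X * Z ^ 6 + 48 * Z ^ 8 := ⟨_, rfl⟩
  have hAo : A % 2 = 1 := by
    obtain ⟨k, hk⟩ : ∃ k, X = 2 * k + 1 := ⟨X / 2, by have := h.X_odd; omega⟩
    rw [hA, hk]; ring_nf; omega
  have hcop : IsCoprime A ((2 * Y * Z) ^ 2) := by
    apply IsCoprime.pow_right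
    refine isCoprime_of_prime_dvd ?_ ?_
    · rintro ⟨h1, -⟩; rw [h1] at hAo; norm_num at hAo
    · intro p hp h1 h2
      have hp2 : ¬ p ∣ 2 := by
        intro h3
        have := hp.associated_of_dvd Int.prime_two h3
        have h4 := this.symm.dvd.trans h1
        omega
      have e : A = (3 * X ^ 2 + 2 * X * Z ^ 2 - 4 * Z ^ 4) ^ 2 - Y * (Y * (8 * X + 4 * Z ^ 2)) := by
        rw [hA]; linear_combination (8 * X + 4 * Z ^ 2) * h.eq
      rcases hp.dvd_or_dvd h2 with h3 | h3
      · rcases hp.dvd_or_dvd h3 with h3 | h3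
        · exact hp2 h3
        · refine h.bad_prime hp hp2 h3 (hp.dvd_of_dvd_pow (n := 2) ?_)
          have := dvd_add h1 (h3.mul_right (Y * (8 * X + 4 * Z ^ 2)))
          rwa [e, sub_add_cancel] at this
      · refine h.not_dvd hp (hp.dvd_of_dvd_pow (n := 4) ?_) h3
        have := dvd_sub h1 (h3.mul_right (8 * X ^ 2 * Z ^ 3 + 64 * X * Z ^ 5 + 48 * Z ^ 7))
        rw [hA] at this
        convert this using 1; ring
  have hpos : 0 < (2 * Y * Z) ^ 2 := by
    have := h.mod3.2
    have := h.zpos.ne'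
    positivity
  have key : ((3 * x ^ 2 + 2 * x - 4) / (2 * y)) ^ 2 - 1 - x - x = (A : ℚ) / (((2 * Y * Z) ^ 2 : ℤ) : ℚ) := by
    have hYq : (Y : ℚ) ≠ 0 := by exact_mod_cast h.mod3.2
    have hZq := h.zq
    have he : (Y : ℚ) ^ 2 = X ^ 3 + X ^ 2 * Z ^ 2 - 4 * X * Z ^ 4 - 8 * Z ^ 6 := by exact_mod_cast h.eq
    rw [hA, h.hx, h.hy]
    push_cast
    field_simp
    linear_combination (-4 * (Z ^ 2 + 2 * X)) * he
  have hn := h'.num_den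
  rw [key] at hn
  rw [Int.isCoprime_iff_gcd_eq_one] at hcop
  rw [Rat.num_div_eq_of_coprime hpos hcop, Rat.den_div_eq_of_coprime hpos hcop] at hn
  constructor
  · refine Int.prime_two.dvd_of_dvd_pow (n := 2) ?_
    rw [← hn.2]; exact ⟨2 * Y ^ 2 * Z ^ 2, by ring⟩
  · rw [← hn.1, hA]
    have := h.X_pos
    have : 0 ≤ 8 * X ^ 2 * Z ^ 4 + 64 * X * Z ^ 6 + 48 * Z ^ 8 := by positivity
    linarith

lemma halve (h : LRep x y X Y Z) (hZ : 2 ∣ Z) {P : EP} (hP : At P x y) :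
    ∃ R : EP, P = R + R := by
  obtain ⟨s, t, h1, h2⟩ := halving X Y Z (h.even_facts hZ).1 hZ h.zpos.ne' h.eq (h.even_coprime hZ) x y h.hx h.hy
  have hy := hP.eq
  have hQ : (s * t - y) ^ 2 = (x + t) ^ 3 + (x + t) ^ 2 - 4 * (x + t) - 8 := by
    linear_combination hy + t ^ 2 * h1 + t * h2
  obtain ⟨R, hR⟩ := at_mk hQ
  obtain ⟨X', Y', Z', h'⟩ := exists_rep hQ
  have := hR.dbl h'.y_ne (l := s) (by linear_combination 2 * t * h1 + h2)
  refine ⟨R, hP.unique ?_⟩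
  convert this using 1
  · linear_combination -h1
  · linear_combination s * h1

end LRep

end

section
lemma exists_G : ∃ G : EP, At G 3 4 := at_mk (by norm_num)

/-- The generator `(3, 4)`. -/
noncomputable def GG : EP := exists_G.choose

lemma GG_at : At GG 3 4 := exists_G.choose_spec

lemma add_G {P : EP} {x y : ℚ} (h : At P x y) (hx : x ≠ 3) :
    ∃ x' y', At (P + GG) x' y' ∧ x' * (x - 3) ^ 2 = 3 * x ^ 2 + 11 * x - 28 - 8 * y := by
  have hx' := sub_ne_zero.2 hx
  refine ⟨_, _, h.add GG_at hx (l := (y - 4) / (x - 3)) (by field_simp), ?_⟩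
  field_simp
  linear_combination h.eq

lemma num_bound {x y x' y' : ℚ} {X Y Z X' Y' Z' : ℤ} (h : LRep x y X Y Z) (h' : LRep x' y' X' Y' Z')
    (hx : x ≠ 3) (he : x' * (x - 3) ^ 2 = 3 * x ^ 2 + 11 * x - 28 - 8 * y) :
    X' * (X - 3 * Z ^ 2) ^ 2 = Z' ^ 2 * (3 * X ^ 2 + 11 * X * Z ^ 2 - 28 * Z ^ 4 - 8 * Y * Z) ∧
    X' ≤ 16 * X ^ 2 := by
  have e : X' * (X - 3 * Z ^ 2) ^ 2 = Z' ^ 2 * (3 * X ^ 2 + 11 * X * Z ^ 2 - 28 * Z ^ 4 - 8 * Y * Z) := by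
    have h1 := h.zq
    have h2 := h'.zq
    rw [h.hx, h.hy, h'.hx] at he
    field_simp at he
    have : (X' * (X - 3 * Z ^ 2) ^ 2 : ℚ) = Z' ^ 2 * (3 * X ^ 2 + 11 * X * Z ^ 2 - 28 * Z ^ 4 - 8 * Y * Z) := by
      linear_combination he
    exact_mod_cast this
  refine ⟨e, ?_⟩
  have hne : X - 3 * Z ^ 2 ≠ 0 := by
    intro h0
    apply hx
    have : (X : ℚ) = 3 * Z ^ 2 := by
      have : X = 3 * Z ^ 2 := by linarith
      exact_mod_cast this
    rw [h.hx, this]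
    have := h.zq
    field_simp
  have hpos : 0 < 3 * X ^ 2 + 11 * X * Z ^ 2 - 28 * Z ^ 4 - 8 * Y * Z := by
    have h1 : 0 < X' * (X - 3 * Z ^ 2) ^ 2 := by have := h'.X_pos; positivity
    rw [e] at h1
    exact pos_of_mul_pos_right h1 (by positivity)
  have hd : X' ∣ 3 * X ^ 2 + 11 * X * Z ^ 2 - 28 * Z ^ 4 - 8 * Y * Z := by
    have : X' ∣ Z' ^ 2 * (3 * X ^ 2 + 11 * X * Z ^ 2 - 28 * Z ^ 4 - 8 * Y * Z) := ⟨_, e.symm⟩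
    exact (h'.cop.pow_right).dvd_of_dvd_mul_left this
  refine (Int.le_of_dvd hpos hd).trans ?_
  have hX := h.X_pos
  have hW := h.X_gt
  have hZ : 0 < Z ^ 2 := pow_pos h.zpos 2
  have b1 : -(8 * Y * Z) ≤ 7 * X ^ 2 := by
    have hs : (8 * Y * Z) ^ 2 ≤ (7 * X ^ 2) ^ 2 := by
      have e1 : (8 * Y * Z) ^ 2 = 64 * (Z ^ 2 * Y ^ 2) := by ring
      have e2 : Y ^ 2 ≤ X ^ 2 * (X + Z ^ 2) := by
        rw [h.eq]
        have : 0 ≤ 4 * X * Z ^ 4 + 8 * Z ^ 6 := by positivity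
        nlinarith
      have e3 : 121 * (Z ^ 2 * (X + Z ^ 2)) ≤ 80 * X ^ 2 := by nlinarith
      have e4 : Z ^ 2 * Y ^ 2 ≤ Z ^ 2 * (X ^ 2 * (X + Z ^ 2)) := mul_le_mul_of_nonneg_left e2 hZ.le
      have e5 := mul_le_mul_of_nonneg_left e3 (sq_nonneg X)
      rw [e1]
      nlinarith [sq_nonneg (X ^ 2)]
    have := (abs_le_of_sq_le_sq' hs (by positivity)).1
    linarith
  have b2 : 11 * X * Z ^ 2 ≤ 5 * X ^ 2 := by nlinarith
  nlinarith [sq_nonneg (Z ^ 2)]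

lemma to_even {P : EP} {x y : ℚ} {X Y Z : ℤ} (hP : At P x y) (h : LRep x y X Y Z) (hZ : ¬ 2 ∣ Z)
    (hx : x ≠ 3) : ∃ Q x' y' X' Y' Z', (Q = P + GG ∨ Q = P - GG) ∧ At Q x' y' ∧ LRep x' y' X' Y' Z' ∧
      2 ∣ Z' ∧ X' ≤ 16 * X ^ 2 := by
  obtain ⟨x1, y1, a1, e1⟩ := add_G hP hx
  obtain ⟨x2, y2, a2, e2⟩ := add_G hP.neg hx
  obtain ⟨X1, Y1, Z1, r1⟩ := exists_rep a1.eq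
  obtain ⟨X2, Y2, Z2, r2⟩ := exists_rep a2.eq
  have b1 := num_bound h r1 hx e1
  have b2 := num_bound h.neg r2 hx e2
  by_cases c1 : 2 ∣ Z1
  · exact ⟨_, _, _, _, _, _, Or.inl rfl, a1, r1, c1, b1.2⟩
  by_cases c2 : 2 ∣ Z2
  · refine ⟨_, _, _, _, _, _, Or.inr rfl, ?_, r2.neg, c2, b2.2⟩
    have := a2.neg
    rwa [neg_add, neg_neg, ← sub_eq_add_neg] at this
  exfalso
  have key : X1 * X2 * (X - 3 * Z ^ 2) ^ 2 = Z1 ^ 2 * Z2 ^ 2 * (9 * X ^ 2 + 56 * X * Z ^ 2 + 144 * Z ^ 4) := by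
    have hne : (X - 3 * Z ^ 2) ^ 2 ≠ 0 := by
      apply pow_ne_zero
      intro h0
      apply hx
      have : (X : ℚ) = 3 * Z ^ 2 := by
        have : X = 3 * Z ^ 2 := by linarith
        exact_mod_cast this
      rw [h.hx, this]
      have := h.zq
      field_simp
    apply mul_right_cancel₀ hne
    have := congrArg₂ (· * ·) b1.1 b2.1
    linear_combination this - 64 * Z1 ^ 2 * Z2 ^ 2 * Z ^ 2 * h.eq
  have o := h.X_odd
  have o1 := r1.X_odd
  have o2 := r2.X_odd
  obtain ⟨k, hk⟩ : ∃ k, X - 3 * Z ^ 2 = 2 * k := by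
    obtain ⟨z, rfl⟩ : ∃ z, Z = 2 * z + 1 := ⟨Z / 2, by omega⟩
    obtain ⟨u, hu⟩ : ∃ u, X = 2 * u + 1 := ⟨X / 2, by omega⟩
    exact ⟨u - 6 * z ^ 2 - 6 * z - 1, by rw [hu]; ring⟩
  have hc : (2 : ℤ) ∣ Z1 ^ 2 * Z2 ^ 2 * (9 * X ^ 2 + 56 * X * Z ^ 2 + 144 * Z ^ 4) := by
    rw [← key, hk]; exact ⟨X1 * X2 * 2 * k ^ 2, by ring⟩
  rcases Int.prime_two.dvd_or_dvd hc with hc | hc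
  · rcases Int.prime_two.dvd_or_dvd hc with hc | hc
    · exact c1 (Int.prime_two.dvd_of_dvd_pow hc)
    · exact c2 (Int.prime_two.dvd_of_dvd_pow hc)
  · have : (2 : ℤ) ∣ 9 * X ^ 2 := by
      have := dvd_sub hc (dvd_mul_right (2 : ℤ) (28 * X * Z ^ 2 + 72 * Z ^ 4))
      have e : 9 * X ^ 2 + 56 * X * Z ^ 2 + 144 * Z ^ 4 - 2 * (28 * X * Z ^ 2 + 72 * Z ^ 4) = 9 * X ^ 2 := by ring
      rwa [e] at this
    rcases Int.prime_two.dvd_or_dvd this with h' | h'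
    · norm_num at h'
    · have := Int.prime_two.dvd_of_dvd_pow h'
      omega

lemma generated (n : ℕ) : ∀ (P : EP) (x y : ℚ) (X Y Z : ℤ), At P x y → LRep x y X Y Z → X.toNat = n →
    ∃ k : ℤ, P = k • GG := by
  induction n using Nat.strong_induction_on with
  | _ n ih =>
  intro P x y X Y Z hP h hn
  have hX := h.X_ge
  have go : ∀ (Q : EP) (x' y' : ℚ) (X' Y' Z' : ℤ), At Q x' y' → LRep x' y' X' Y' Z' → 2 ∣ Z' → X' < X ^ 4 →
      ∃ k : ℤ, Q = k • GG := by
    intro Q x' y' X' Y' Z' hQ h' hZ' hlt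
    obtain ⟨R, hR⟩ := h'.halve hZ' hQ
    rcases zero_or_at R with rfl | ⟨xr, yr, hRa⟩
    · exact ⟨0, by rw [hR]; simp⟩
    obtain ⟨Xr, Yr, Zr, hr⟩ := exists_rep hRa.eq
    obtain ⟨x2, y2, X2, Y2, Z2, h2a, h2, -, hle⟩ := hr.dbl_rep hRa
    rw [← hR] at h2a
    obtain ⟨rfl, rfl⟩ := h2a.inj hQ
    have hXX : X2 = X' := by rw [← h2.num_den.1, ← h'.num_den.1]
    have hlt2 : Xr < X := by
      by_contra hc
      push Not at hc
      have := pow_le_pow_left₀ (by omega : 0 ≤ X) hc 4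
      omega
    have hrp := hr.X_pos
    obtain ⟨k, hk⟩ := ih Xr.toNat (by omega) R xr yr Xr Yr Zr hRa hr rfl
    exact ⟨k + k, by rw [hR, add_zsmul, ← hk]⟩
  by_cases hZ : 2 ∣ Z
  · refine go P x y X Y Z hP h hZ ?_
    calc X < X * 3 := by omega
      _ ≤ X * X ^ 3 := by
          have : 1 ≤ X ^ 2 := by nlinarith
          apply mul_le_mul_of_nonneg_left _ (by omega); nlinarith
      _ = X ^ 4 := by ring
  · by_cases hx : x = 3
    · subst hx
      rcases GG_at.eq_or_neg hP with rfl | rfl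
      · exact ⟨1, by simp⟩
      · exact ⟨-1, by simp⟩
    · obtain ⟨Q, x', y', X', Y', Z', hQ, hQa, h', hZ', hle⟩ := to_even hP h hZ hx
      have hX5 : 5 ≤ X := by
        by_contra hc
        have hX3 : X = 3 := by have := h.X_odd; omega
        have hW := h.X_gt
        have hW1 : Z ^ 2 = 1 := by have := pow_pos h.zpos 2; omega
        apply hx
        rw [h.hx, hX3]
        have : (Z : ℚ) ^ 2 = 1 := by exact_mod_cast hW1
        rw [this]; norm_num
      obtain ⟨k, hk⟩ := go Q x' y' X' Y' Z' hQa h' hZ' (by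
        have h25 : 25 ≤ X ^ 2 := by nlinarith
        have e4 : X ^ 4 = X ^ 2 * X ^ 2 := by ring
        rw [e4]; nlinarith)
      rcases hQ with hQ | hQ
      · exact ⟨k - 1, by rw [sub_zsmul, ← hk, hQ]; simp⟩
      · exact ⟨k + 1, by rw [add_zsmul, ← hk, hQ]; simp⟩

end

section
lemma add_gen {P Q : EP} {x1 y1 x2 y2 : ℚ} (h1 : At P x1 y1) (h2 : At Q x2 y2) (hx : x1 ≠ x2) :
    ∃ x3 y3, At (P + Q) x3 y3 ∧
      x3 * (x1 - x2) ^ 2 = (x1 * x2 - 4) * (x1 + x2) + 2 * x1 * x2 - 16 - 2 * y1 * y2 := by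
  have hx' := sub_ne_zero.2 hx
  refine ⟨_, _, h1.add h2 hx (l := (y1 - y2) / (x1 - x2)) (by field_simp), ?_⟩
  field_simp
  linear_combination h1.eq + h2.eq

/-- `P` is in the kernel of reduction modulo `p`. -/
def InKer (p : ℤ) (P : EP) : Prop :=
  ∀ x y X Y Z, At P x y → LRep x y X Y Z → p ∣ Z

lemma LRep.uniq {x y : ℚ} {X Y Z X' Y' Z' : ℤ} (h : LRep x y X Y Z) (h' : LRep x y X' Y' Z') :
    X = X' ∧ Z = Z' := by
  have a := h.num_den
  have b := h'.num_den
  refine ⟨a.1.symm.trans b.1, ?_⟩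
  have : Z ^ 2 = Z' ^ 2 := a.2.symm.trans b.2
  have h1 := h.zpos
  have h2 := h'.zpos
  nlinarith

lemma InKer.neg {p : ℤ} {P : EP} (h : InKer p P) : InKer p (-P) := by
  intro x y X Y Z hP hr
  have := hP.neg
  rw [neg_neg] at this
  exact h _ _ _ _ _ this hr.neg

lemma InKer.add_notin {p : ℤ} (hp : Prime p) {P T : EP} (hT : InKer p T) {x y : ℚ} {X Y Z : ℤ}
    (hP : At P x y) (h : LRep x y X Y Z) (hZ : ¬ p ∣ Z) :
    ∃ x' y' X' Y' Z', At (P + T) x' y' ∧ LRep x' y' X' Y' Z' ∧ ¬ p ∣ Z' ∧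
      p ∣ X' * Z ^ 2 - X * Z' ^ 2 := by
  rcases zero_or_at T with rfl | ⟨x2, y2, hTa⟩
  · exact ⟨x, y, X, Y, Z, by rwa [add_zero], h, hZ, by simp⟩
  obtain ⟨X2, Y2, Z2, h2⟩ := exists_rep hTa.eq
  have hZ2 := hT _ _ _ _ _ hTa h2
  have hx : x ≠ x2 := by
    rintro rfl
    have e : Z ^ 2 = Z2 ^ 2 := h.num_den.2.symm.trans h2.num_den.2
    apply hZ
    refine hp.dvd_of_dvd_pow (n := 2) ?_
    rw [e]; exact hZ2.trans (dvd_pow_self _ (by norm_num))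
  obtain ⟨x3, y3, h3a, e⟩ := add_gen hP hTa hx
  obtain ⟨X3, Y3, Z3, h3⟩ := exists_rep h3a.eq
  have key : X3 * (X * Z2 ^ 2 - X2 * Z ^ 2) ^ 2 = Z3 ^ 2 * ((X * X2 - 4 * Z ^ 2 * Z2 ^ 2) * (X * Z2 ^ 2 + X2 * Z ^ 2)
      + 2 * X * X2 * Z ^ 2 * Z2 ^ 2 - 16 * Z ^ 4 * Z2 ^ 4 - 2 * Y * Y2 * Z * Z2) := by
    have n1 := h.zq
    have n2 := h2.zq
    have n3 := h3.zq
    rw [h.hx, h.hy, h2.hx, h2.hy, h3.hx] at e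
    field_simp at e
    have : (X3 * (X * Z2 ^ 2 - X2 * Z ^ 2) ^ 2 : ℚ) = Z3 ^ 2 * ((X * X2 - 4 * Z ^ 2 * Z2 ^ 2) * (X * Z2 ^ 2 + X2 * Z ^ 2)
      + 2 * X * X2 * Z ^ 2 * Z2 ^ 2 - 16 * Z ^ 4 * Z2 ^ 4 - 2 * Y * Y2 * Z * Z2) := by
      linear_combination e
    exact_mod_cast this
  have hX2 : ¬ p ∣ X2 := fun h' => h2.not_dvd hp h' hZ2
  have main : p ∣ X2 ^ 2 * Z ^ 2 * (X3 * Z ^ 2 - X * Z3 ^ 2) := by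
    obtain ⟨k, hk⟩ := hZ2
    have : p ∣ X3 * (X * Z2 ^ 2 - X2 * Z ^ 2) ^ 2 - Z3 ^ 2 * ((X * X2 - 4 * Z ^ 2 * Z2 ^ 2) * (X * Z2 ^ 2 + X2 * Z ^ 2)
      + 2 * X * X2 * Z ^ 2 * Z2 ^ 2 - 16 * Z ^ 4 * Z2 ^ 4 - 2 * Y * Y2 * Z * Z2) := by
      rw [key, sub_self]; exact dvd_zero _
    have e2 : X2 ^ 2 * Z ^ 2 * (X3 * Z ^ 2 - X * Z3 ^ 2) =
      (X3 * (X * Z2 ^ 2 - X2 * Z ^ 2) ^ 2 - Z3 ^ 2 * ((X * X2 - 4 * Z ^ 2 * Z2 ^ 2) * (X * Z2 ^ 2 + X2 * Z ^ 2)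
      + 2 * X * X2 * Z ^ 2 * Z2 ^ 2 - 16 * Z ^ 4 * Z2 ^ 4 - 2 * Y * Y2 * Z * Z2)) - 
      Z2 * (X3 * (X ^ 2 * Z2 ^ 3 - 2 * X * X2 * Z ^ 2 * Z2) - Z3 ^ 2 * (X ^ 2 * X2 * Z2 
       - 4 * Z ^ 2 * Z2 * (X * Z2 ^ 2 + X2 * Z ^ 2) + 2 * X * X2 * Z ^ 2 * Z2 - 16 * Z ^ 4 * Z2 ^ 3
        - 2 * Y * Y2 * Z)) := by ring
    rw [e2]
    exact dvd_sub this (Dvd.dvd.mul_right ⟨k, hk⟩ _)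
  have main' : p ∣ X3 * Z ^ 2 - X * Z3 ^ 2 := by
    rcases hp.dvd_or_dvd main with h' | h'
    · rcases hp.dvd_or_dvd h' with h' | h'
      · exact (hX2 (hp.dvd_of_dvd_pow h')).elim
      · exact (hZ (hp.dvd_of_dvd_pow h')).elim
    · exact h'
  refine ⟨x3, y3, X3, Y3, Z3, h3a, h3, ?_, main'⟩
  intro hZ3
  have : p ∣ X3 * Z ^ 2 := by
    have := dvd_add main' (hZ3.mul_right (X * Z3))
    have e3 : X3 * Z ^ 2 - X * Z3 ^ 2 + Z3 * (X * Z3) = X3 * Z ^ 2 := by ring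
    rwa [e3] at this
  rcases hp.dvd_or_dvd this with h' | h'
  · exact h3.not_dvd hp h' hZ3
  · exact hZ (hp.dvd_of_dvd_pow h')

/-- The kernel of reduction as a subgroup. -/
def kerSub (p : ℤ) (hp : Prime p) : AddSubgroup EP where
  carrier := {P | InKer p P}
  zero_mem' := fun _ _ _ _ _ h => (h.ne_zero rfl).elim
  neg_mem' := fun h => InKer.neg h
  add_mem' := by
    intro a b ha hb x y X Y Z hP h
    by_contra hZ
    obtain ⟨x', y', X', Y', Z', hP', h', hZ', -⟩ := InKer.add_notin hp (InKer.neg hb) hP h hZ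
    rw [add_neg_cancel_right] at hP'
    exact hZ' (ha _ _ _ _ _ hP' h')

lemma triple {P : EP} {x y ψ : ℚ} (h : At P x y) (hy : y ≠ 0)
    (hψ : ψ = 3 * x ^ 4 + 4 * x ^ 3 - 24 * x ^ 2 - 96 * x - 48) (hψ0 : ψ ≠ 0) :
    ∃ x' y', At (P + P + P) x' y' ∧
      x' * ψ ^ 2 = x * ψ ^ 2 + 8 * y ^ 2 * (8 * y ^ 4 - (3 * x ^ 2 + 2 * x - 4) * ψ) := by
  obtain ⟨l, hl⟩ : ∃ l, l * (2 * y) = 3 * x ^ 2 + 2 * x - 4 := ⟨(3 * x ^ 2 + 2 * x - 4) / (2 * y), by field_simp⟩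
  have h2 := h.dbl hy hl
  obtain ⟨d, hd⟩ : ∃ d, d = l ^ 2 - 1 - x - x - x := ⟨_, rfl⟩
  have hdψ : 4 * y ^ 2 * d = -ψ := by
    rw [hd, hψ]
    linear_combination (l * (2 * y) + 3 * x ^ 2 + 2 * x - 4) * hl - 4 * (1 + 3 * x) * h.eq
  have hd0 : d ≠ 0 := by
    rintro rfl; apply hψ0; linarith
  have hne : l ^ 2 - 1 - x - x ≠ x := by
    intro h'; apply hd0; rw [hd, h', sub_self]
  refine ⟨_, _, h2.add h hne (l := -l - 2 * y / d) ?_, ?_⟩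
  · rw [← hd]; field_simp; ring
  · have e : ψ = -(4 * y ^ 2 * d) := by linarith
    rw [← hl, e]
    have e2 : l ^ 2 = d + 1 + x + x + x := by rw [hd]; ring
    field_simp
    linear_combination 0 * e2

end

section
open NumberTheorySymbols in
lemma exists_prime_jacobi (M Ψ Z : ℤ) (hM : 0 < M) (hM4 : M % 4 = 1) (hΨ : Ψ % 2 = 1)
    (hcop : IsCoprime Z M) (hd : M ∣ Ψ - 23 * Z ^ 8) (h23 : J(M | 23) = -1) :
    ∃ p : ℕ, p.Prime ∧ (p : ℤ) ∣ Ψ ∧ J(M | p) = -1 := by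
  obtain ⟨m, rfl⟩ := Int.eq_ofNat_of_zero_le hM.le
  have hm4 : m % 4 = 1 := by omega
  have hmo : Odd m := Nat.odd_iff.2 (by omega)
  have e1 : J((m : ℤ) | Ψ.natAbs) = J((Ψ.natAbs : ℤ) | m) :=
    jacobiSym.quadratic_reciprocity_one_mod_four hm4 (Nat.odd_iff.2 (by omega))
  have e2 : J((Ψ.natAbs : ℤ) | m) = J(Ψ | m) := by
    rcases Int.natAbs_eq Ψ with h | h
    · rw [← h]
    · have : (Ψ.natAbs : ℤ) = - Ψ := by omega
      rw [this, jacobiSym.neg _ hmo, ZMod.χ₄_nat_one_mod_four hm4, one_mul]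
  have e3 : J(Ψ | m) = J(23 * Z ^ 8 | m) :=
    jacobiSym.mod_left' (Int.emod_eq_emod_iff_emod_sub_eq_zero.2 (Int.emod_eq_zero_of_dvd hd))
  have e4 : J(23 * Z ^ 8 | m) = J(23 | m) := by
    have hg : Z.gcd m = 1 := Int.isCoprime_iff_gcd_eq_one.1 hcop
    rw [jacobiSym.mul_left, jacobiSym.pow_left, show 8 = 2 * 4 by rfl, pow_mul, jacobiSym.sq_one hg]
    simp
  have e5 : J((m : ℤ) | 23) = J(((23 : ℕ) : ℤ) | m) :=
    jacobiSym.quadratic_reciprocity_one_mod_four hm4 (by decide)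
  have e6 : J((m : ℤ) | Ψ.natAbs) = -1 := by
    rw [e1, e2, e3, e4, ← h23, e5]; rfl
  obtain ⟨p, hp, hpd, hj⟩ := jacobiSym.eq_neg_one_at_prime_divisor_of_eq_neg_one e6
  exact ⟨p, hp, Int.natCast_dvd.2 hpd, hj⟩

lemma LRep.psi_odd {x y : ℚ} {X Y Z : ℤ} (h : LRep x y X Y Z) :
    (3 * X ^ 4 + 4 * X ^ 3 * Z ^ 2 - 24 * X ^ 2 * Z ^ 4 - 96 * X * Z ^ 6 - 48 * Z ^ 8) % 2 = 1 := by
  obtain ⟨u, hu⟩ : ∃ u, X = 2 * u + 1 := ⟨X / 2, by have := h.X_odd; omega⟩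
  rw [hu]; ring_nf; omega

/-- Integral form of the tripling formula. -/
lemma triple_rep {P : EP} {x y : ℚ} {X Y Z : ℤ} (hP : At P x y) (h : LRep x y X Y Z) :
    ∃ x' y' X' Y' Z', At (P + P + P) x' y' ∧ LRep x' y' X' Y' Z' ∧
      X' * Z ^ 2 * (3 * X ^ 4 + 4 * X ^ 3 * Z ^ 2 - 24 * X ^ 2 * Z ^ 4 - 96 * X * Z ^ 6 - 48 * Z ^ 8) ^ 2 =
      Z' ^ 2 * (X * (3 * X ^ 4 + 4 * X ^ 3 * Z ^ 2 - 24 * X ^ 2 * Z ^ 4 - 96 * X * Z ^ 6 - 48 * Z ^ 8) ^ 2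
        + 8 * Y ^ 2 * (8 * Y ^ 4 - (3 * X ^ 2 + 2 * X * Z ^ 2 - 4 * Z ^ 4) *
        (3 * X ^ 4 + 4 * X ^ 3 * Z ^ 2 - 24 * X ^ 2 * Z ^ 4 - 96 * X * Z ^ 6 - 48 * Z ^ 8))) := by
  have hZ := h.zq
  have hΨ : (3 * X ^ 4 + 4 * X ^ 3 * Z ^ 2 - 24 * X ^ 2 * Z ^ 4 - 96 * X * Z ^ 6 - 48 * Z ^ 8) % 2 = 1 := by
    exact h.psi_odd
  obtain ⟨Ψ, hΨe⟩ : ∃ Ψ, Ψ = 3 * X ^ 4 + 4 * X ^ 3 * Z ^ 2 - 24 * X ^ 2 * Z ^ 4 - 96 * X * Z ^ 6 - 48 * Z ^ 8 := ⟨_, rfl⟩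
  rw [← hΨe] at hΨ ⊢
  have hΨ0 : (Ψ : ℚ) ≠ 0 := by
    have : Ψ ≠ 0 := by rintro h; rw [h] at hΨ; norm_num at hΨ
    exact_mod_cast this
  have hψ : (Ψ : ℚ) / Z ^ 8 = 3 * x ^ 4 + 4 * x ^ 3 - 24 * x ^ 2 - 96 * x - 48 := by
    rw [hΨe, h.hx]; push_cast; field_simp
  obtain ⟨x', y', h3, e⟩ := triple hP h.y_ne hψ (by positivity)
  obtain ⟨X', Y', Z', r⟩ := exists_rep h3.eq
  refine ⟨x', y', X', Y', Z', h3, r, ?_⟩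
  have hZ' := r.zq
  rw [h.hx, h.hy, r.hx] at e
  field_simp at e
  have : (X' * Z ^ 2 * Ψ ^ 2 : ℚ) = Z' ^ 2 * (X * Ψ ^ 2 + 8 * Y ^ 2 * (8 * Y ^ 4 - (3 * X ^ 2 + 2 * X * Z ^ 2 - 4 * Z ^ 4) * Ψ)) := by
    linear_combination e
  exact_mod_cast this

/-- residues modulo `23` in the orbit -/
def T23 (c : ZMod 23) : Prop := c = 18 ∨ c = 20 ∨ c = 14 ∨ c = 6

instance (c : ZMod 23) : Decidable (T23 c) := by unfold T23; infer_instance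

/-- first polynomial -/
def psi23 (c : ZMod 23) : ZMod 23 := 3 * c ^ 4 + 4 * c ^ 3 - 24 * c ^ 2 - 96 * c - 48

/-- second polynomial -/
def tau23 (c : ZMod 23) : ZMod 23 :=
  c * psi23 c ^ 2 + 8 * (c ^ 3 + c ^ 2 - 4 * c - 8) * (8 * (c ^ 3 + c ^ 2 - 4 * c - 8) ^ 2 - (3 * c ^ 2 + 2 * c - 4) * psi23 c)

lemma orbit23 : ∀ c : ZMod 23, T23 c → ∃ i, psi23 c ^ 2 * i = 1 ∧ T23 (tau23 c * i) := by
  rintro c (rfl | rfl | rfl | rfl) <;> decide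

lemma nonres23 : ∀ c z : ZMod 23, T23 c → z ≠ 0 → ¬ IsSquare ((c + 1) * z ^ 2) := by
  have key : ∀ z : ZMod 23, z ≠ 0 → ∀ r : ZMod 23, r * r ≠ 19 * z ^ 2 ∧ r * r ≠ 21 * z ^ 2 ∧ r * r ≠ 15 * z ^ 2 ∧ r * r ≠ 7 * z ^ 2 := by
    decide
  rintro c z hc hz ⟨r, hr⟩
  obtain ⟨h1, h2, h3, h4⟩ := key z hz r
  rcases hc with (rfl | rfl | rfl | rfl)
  · exact h1 (hr.symm.trans (by congr 1))
  · exact h2 (hr.symm.trans (by congr 1))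
  · exact h3 (hr.symm.trans (by congr 1))
  · exact h4 (hr.symm.trans (by congr 1))

/-- invariant -/
def InvS (P : EP) (x y : ℚ) (X Y Z : ℤ) : Prop :=
  At P x y ∧ LRep x y X Y Z ∧ 2 ∣ Z ∧ (Z : ZMod 23) ≠ 0 ∧ ∃ c, T23 c ∧ (X : ZMod 23) = c * Z ^ 2

instance fact23 : Fact (Nat.Prime 23) := ⟨by norm_num⟩

lemma InvS.step {P : EP} {x y : ℚ} {X Y Z : ℤ} (h : InvS P x y X Y Z) :
    ∃ x' y' X' Y' Z', InvS (P + P + P) x' y' X' Y' Z' := by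
  obtain ⟨hP, hr, hZ, hz, c, hc, hX⟩ := h
  obtain ⟨x', y', X', Y', Z', hP', r, e⟩ := triple_rep hP hr
  refine ⟨x', y', X', Y', Z', hP', r, ?_, ?_⟩
  · have h1 : (2 : ℤ) ∣ Z' ^ 2 * (X * (3 * X ^ 4 + 4 * X ^ 3 * Z ^ 2 - 24 * X ^ 2 * Z ^ 4 - 96 * X * Z ^ 6 - 48 * Z ^ 8) ^ 2
        + 8 * Y ^ 2 * (8 * Y ^ 4 - (3 * X ^ 2 + 2 * X * Z ^ 2 - 4 * Z ^ 4) *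
        (3 * X ^ 4 + 4 * X ^ 3 * Z ^ 2 - 24 * X ^ 2 * Z ^ 4 - 96 * X * Z ^ 6 - 48 * Z ^ 8))) := by
      rw [← e]
      exact Dvd.dvd.mul_right (Dvd.dvd.mul_left (hZ.trans (dvd_pow_self _ (by norm_num))) _) _
    rcases Int.prime_two.dvd_or_dvd h1 with h2 | h2
    · exact Int.prime_two.dvd_of_dvd_pow h2
    · exfalso
      have hΨ := hr.psi_odd
      have hXo := hr.X_odd
      rw [mul_assoc 8] at h2
      have h3 := (dvd_add_left (Dvd.dvd.mul_right (by norm_num : (2 : ℤ) ∣ 8) _)).1 h2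
      rcases Int.prime_two.dvd_or_dvd h3 with h4 | h4
      · omega
      · have := Int.prime_two.dvd_of_dvd_pow h4
        omega
  · have e' := congrArg (Int.cast : ℤ → ZMod 23) e
    have hy := congrArg (Int.cast : ℤ → ZMod 23) hr.eq
    push_cast at e' hy
    rw [hX] at e' hy
    have hy4 : (Y : ZMod 23) ^ 4 = ((Y : ZMod 23) ^ 2) ^ 2 := by ring
    rw [hy4, hy] at e'
    have e2 : (Z : ZMod 23) ^ 18 * (X' * psi23 c ^ 2) = (Z : ZMod 23) ^ 18 * (Z' ^ 2 * tau23 c) := by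
      unfold tau23 psi23
      linear_combination e'
    have e3 := mul_left_cancel₀ (pow_ne_zero 18 hz) e2
    obtain ⟨i, hi, ht⟩ := orbit23 c hc
    have e4 : (X' : ZMod 23) = tau23 c * i * Z' ^ 2 := by
      linear_combination (-(X' : ZMod 23)) * hi + i * e3
    refine ⟨?_, _, ht, e4⟩
    intro hz'
    rw [hz'] at e4
    have e5 : (X' : ZMod 23) = 0 := by rw [e4]; ring
    exact r.not_dvd (p := 23) (Int.prime_iff_natAbs_prime.2 (by norm_num)) ((ZMod.intCast_zmod_eq_zero_iff_dvd _ 23).1 e5)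
      ((ZMod.intCast_zmod_eq_zero_iff_dvd _ 23).1 hz')

open NumberTheorySymbols in
lemma InvS.prime {P : EP} {x y : ℚ} {X Y Z : ℤ} (h : InvS P x y X Y Z) :
    ∃ p : ℕ, p.Prime ∧ ¬ (p : ℤ) ∣ Z ∧ J(X + Z ^ 2 | p) = -1 ∧ InKer p (P + P + P) := by
  obtain ⟨hP, hr, hZ, hz, c, hc, hX⟩ := h
  obtain ⟨x', y', X', Y', Z', hP', r, e⟩ := triple_rep hP hr
  have hΨ := hr.psi_odd
  have hM : 0 < X + Z ^ 2 := by have := hr.X_pos; positivity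
  have hM4 : (X + Z ^ 2) % 4 = 1 := by
    have h1 := (hr.even_facts hZ).1
    obtain ⟨k, rfl⟩ := hZ
    ring_nf; omega
  have hcop : IsCoprime Z (X + Z ^ 2) := by
    have := hr.cop.symm.add_mul_left_right Z
    rwa [← sq] at this
  have hd : X + Z ^ 2 ∣ (3 * X ^ 4 + 4 * X ^ 3 * Z ^ 2 - 24 * X ^ 2 * Z ^ 4 - 96 * X * Z ^ 6 - 48 * Z ^ 8) - 23 * Z ^ 8 :=
    ⟨3 * X ^ 3 + X ^ 2 * Z ^ 2 - 25 * X * Z ^ 4 - 71 * Z ^ 6, by ring⟩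
  have h23 : J(X + Z ^ 2 | 23) = -1 := by
    rw [← jacobiSym.legendreSym.to_jacobiSym 23, legendreSym.eq_neg_one_iff]
    have := nonres23 c Z hc hz
    push_cast
    rw [hX]
    convert this using 2; ring
  obtain ⟨p, hp, hpd, hj⟩ := exists_prime_jacobi _ _ Z hM hM4 hΨ hcop hd h23
  have hpi : Prime (p : ℤ) := Nat.prime_iff_prime_int.1 hp
  have hp2 : ¬ (p : ℤ) ∣ 2 := by
    intro h2
    have h3 := (hpi.associated_of_dvd Int.prime_two h2).symm.dvd.trans hpd
    omega
  have hpZ : ¬ (p : ℤ) ∣ Z := by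
    intro hpZ
    have h1 : (p : ℤ) ∣ 3 * X ^ 4 := by
      have := dvd_sub hpd (hpZ.mul_right (4 * X ^ 3 * Z - 24 * X ^ 2 * Z ^ 3 - 96 * X * Z ^ 5 - 48 * Z ^ 7))
      have e1 : 3 * X ^ 4 + 4 * X ^ 3 * Z ^ 2 - 24 * X ^ 2 * Z ^ 4 - 96 * X * Z ^ 6 - 48 * Z ^ 8 -
        Z * (4 * X ^ 3 * Z - 24 * X ^ 2 * Z ^ 3 - 96 * X * Z ^ 5 - 48 * Z ^ 7) = 3 * X ^ 4 := by ring
      rwa [e1] at this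
    rcases hpi.dvd_or_dvd h1 with h2 | h2
    · have h3 : p ∣ 3 := by exact_mod_cast h2
      have h4 : p = 3 := (Nat.prime_dvd_prime_iff_eq hp Nat.prime_three).1 h3
      subst h4
      rw [jacobiSym.mod_left] at hj
      have := hr.mod3.1
      rw [show ((3 : ℕ) : ℤ) = 3 by rfl, this, jacobiSym.one_left] at hj
      norm_num at hj
    · exact hr.not_dvd hpi (hpi.dvd_of_dvd_pow h2) hpZ
  have hpY : ¬ (p : ℤ) ∣ Y := by
    intro hY
    refine hr.bad_prime hpi hp2 hY (hpi.dvd_of_dvd_pow (n := 2) ?_)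
    have := dvd_sub (hY.mul_right (Y * (2 * (6 * X + 2 * Z ^ 2)))) hpd
    have e1 : Y * (Y * (2 * (6 * X + 2 * Z ^ 2))) -
      (3 * X ^ 4 + 4 * X ^ 3 * Z ^ 2 - 24 * X ^ 2 * Z ^ 4 - 96 * X * Z ^ 6 - 48 * Z ^ 8) =
       (3 * X ^ 2 + 2 * X * Z ^ 2 - 4 * Z ^ 4) ^ 2 := by
      linear_combination (2 * (6 * X + 2 * Z ^ 2)) * hr.eq
    rwa [e1] at this
  refine ⟨p, hp, hpZ, hj, ?_⟩
  intro x2 y2 X2 Y2 Z2 hP2 r2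
  obtain ⟨rfl, rfl⟩ := hP2.inj hP'
  rw [(r2.uniq r).2]
  obtain ⟨Ψ, hΨe⟩ : ∃ Ψ, Ψ = 3 * X ^ 4 + 4 * X ^ 3 * Z ^ 2 - 24 * X ^ 2 * Z ^ 4 - 96 * X * Z ^ 6 - 48 * Z ^ 8 := ⟨_, rfl⟩
  rw [← hΨe] at e hpd
  have h1 : (p : ℤ) ∣ 2 ^ 6 * Y ^ 6 * Z' ^ 2 := by
    have e1 : 2 ^ 6 * Y ^ 6 * Z' ^ 2 = Ψ * (X' * Z ^ 2 * Ψ - Z' ^ 2 * (X * Ψ - 8 * Y ^ 2 * (3 * X ^ 2 + 2 * X * Z ^ 2 - 4 * Z ^ 4))) := by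
      linear_combination -e
    rw [e1]; exact hpd.mul_right _
  rcases hpi.dvd_or_dvd h1 with h2 | h2
  · rcases hpi.dvd_or_dvd h2 with h2 | h2
    · exact (hp2 (hpi.dvd_of_dvd_pow h2)).elim
    · exact (hpY (hpi.dvd_of_dvd_pow h2)).elim
  · exact hpi.dvd_of_dvd_pow h2

lemma InvS.zero : ∃ x y X Y Z, InvS (GG + GG) x y X Y Z := by
  have h := GG_at.dbl (by norm_num) (l := 29 / 8) (by norm_num)
  norm_num at h
  obtain ⟨X, Y, Z, r⟩ := exists_rep h.eq
  have hn := r.num_den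
  have e1 : X = 393 := by rw [← hn.1]; norm_num
  have e2 : Z ^ 2 = 64 := by rw [← hn.2]; norm_num
  have e3 : Z = 8 := by have := r.zpos; nlinarith
  refine ⟨_, _, X, Y, Z, h, r, by rw [e3]; norm_num, by rw [e3]; decide, 18, Or.inl rfl, by rw [e1, e3]; decide⟩

lemma InvS.all (l : ℕ) : ∃ x y X Y Z, InvS ((2 * 3 ^ l : ℤ) • GG) x y X Y Z := by
  induction l with
  | zero => simpa [two_zsmul] using InvS.zero
  | succ l ih =>
    obtain ⟨x, y, X, Y, Z, h⟩ := ih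
    have := h.step
    rwa [← add_zsmul, ← add_zsmul, show (2 * 3 ^ l + 2 * 3 ^ l + 2 * 3 ^ l : ℤ) = 2 * 3 ^ (l + 1) by ring] at this

lemma no_square_aux {m : ℤ} (hm : m ≠ 0) {x y : ℚ} {X Y Z s : ℤ} (hP : At ((2 * m) • GG) x y)
    (h : LRep x y X Y Z) (hs : X + Z ^ 2 = s ^ 2) : False := by
  obtain ⟨l, j, hj, rfl⟩ : ∃ (l : ℕ) (j : ℤ), ¬ 3 ∣ j ∧ m = 3 ^ l * j := by
    have hfin : FiniteMultiplicity (3 : ℤ) m := Int.finiteMultiplicity_iff.2 ⟨by norm_num, hm⟩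
    obtain ⟨j, hj1, hj2⟩ := hfin.exists_eq_pow_mul_and_not_dvd
    exact ⟨_, j, hj2, hj1⟩
  obtain ⟨xs, ys, Xs, Ys, Zs, hS⟩ := InvS.all l
  obtain ⟨p, hp, hpZ, hJ, hker⟩ := hS.prime
  obtain ⟨hSa, hSr, -⟩ := hS
  have hpi : Prime (p : ℤ) := Nat.prime_iff_prime_int.1 hp
  set S : EP := (2 * 3 ^ l : ℤ) • GG with hSdef
  have hPS : (2 * (3 ^ l * j)) • GG = j • S := by
    rw [hSdef, ← mul_zsmul']; congr 1; ring
  have hq : ∀ q : ℤ, InKer p (q • (S + S + S)) := fun q =>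
    (kerSub p hpi).zsmul_mem (x := S + S + S) hker q
  have main : ∃ (x' y' : ℚ) (X' Y' Z' : ℤ), At (j • S) x' y' ∧ LRep x' y' X' Y' Z' ∧ ¬ (p : ℤ) ∣ Z' ∧
      (p : ℤ) ∣ X' * Zs ^ 2 - Xs * Z' ^ 2 := by
    rcases (by omega : j % 3 = 1 ∨ j % 3 = 2) with h3 | h3
    · have := (hq (j / 3)).add_notin hpi hSa hSr hpZ
      have e : S + (j / 3) • (S + S + S) = j • S := by
        have : j = 1 + (j / 3 + j / 3 + j / 3) := by omega
        conv_rhs => rw [this]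
        simp only [add_zsmul, one_zsmul, zsmul_add]
      rwa [e] at this
    · have := (hq (j / 3 + 1)).add_notin hpi hSa.neg hSr.neg hpZ
      have e : -S + (j / 3 + 1) • (S + S + S) = j • S := by
        have : j = -1 + ((j / 3 + 1) + (j / 3 + 1) + (j / 3 + 1)) := by omega
        conv_rhs => rw [this]
        simp only [add_zsmul, one_zsmul, zsmul_add, neg_zsmul]
      rwa [e] at this
  obtain ⟨x', y', X', Y', Z', hP', r', hpZ', hd⟩ := main
  rw [hPS] at hP
  obtain ⟨rfl, rfl⟩ := hP.inj hP'
  obtain ⟨rfl, rfl⟩ := h.uniq r'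
  have : Fact p.Prime := ⟨hp⟩
  have := jacobiSym.prime_dvd_of_eq_neg_one hJ (x := s * Zs) (y := Z) (by
    have e : (s * Zs) ^ 2 - (Xs + Zs ^ 2) * Z ^ 2 = X * Zs ^ 2 - Xs * Z ^ 2 := by
      linear_combination (-Zs ^ 2) * hs
    rw [e]; exact hd)
  exact hpZ' this.2

lemma no_square {x y : ℚ} {X Y Z s : ℤ} (h : y ^ 2 = x ^ 3 + x ^ 2 - 4 * x - 8)
    (hr : LRep x y X Y Z) (hZ : 2 ∣ Z) (hs : X + Z ^ 2 = s ^ 2) : False := by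
  obtain ⟨P, hP⟩ := at_mk h
  obtain ⟨R, hR⟩ := hr.halve hZ hP
  have hR0 : R ≠ 0 := by
    rintro rfl; exact hP.ne_zero (by rw [hR, add_zero])
  obtain ⟨xr, yr, hRa⟩ := (zero_or_at R).resolve_left hR0
  obtain ⟨Xr, Yr, Zr, rr⟩ := exists_rep hRa.eq
  obtain ⟨k, hk⟩ := generated _ R xr yr Xr Yr Zr hRa rr rfl
  refine no_square_aux (m := k) ?_ (by rw [two_mul, add_zsmul, ← hk, ← hR]; exact hP) hr hs
  rintro rfl
  exact hR0 (by rw [hk, zero_zsmul])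

end

section
lemma sq_or_41 {A B c : ℤ} (hA : 0 < A) (h : A * B = c ^ 2)
    (hp : ∀ p : ℤ, Prime p → p ∣ A → p ∣ B → p ∣ 41) :
    ∃ d, d ≠ 0 ∧ (A = d ^ 2 ∨ A = 41 * d ^ 2) := by
  obtain ⟨n, rfl⟩ := Int.eq_ofNat_of_zero_le hA.le
  obtain ⟨r, d, hrd, hsq⟩ := Nat.sq_mul_squarefree n
  subst hrd
  push_cast at *
  have hd0 : (d : ℤ) ≠ 0 := by rintro h0; rw [h0] at hA; simp at hA
  have hdc : (d : ℤ) ∣ c := by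
    rw [← Int.pow_dvd_pow_iff (n := 2) (by norm_num), ← h, mul_assoc]; exact dvd_mul_right _ _
  obtain ⟨e, rfl⟩ := hdc
  have h2 : (r : ℤ) * B = e ^ 2 := by
    apply mul_left_cancel₀ (pow_ne_zero 2 hd0)
    linear_combination h
  have key : ∀ l : ℕ, l.Prime → l ∣ r → l = 41 := by
    intro l hl hlr
    have hli : Prime (l : ℤ) := Nat.prime_iff_prime_int.1 hl
    obtain ⟨s, rfl⟩ := hlr
    have hls : ¬ l ∣ s := by
      rintro ⟨k, rfl⟩
      have := hsq l ⟨k, by ring⟩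
      exact hl.one_lt.ne' (Nat.isUnit_iff.1 this)
    push_cast at h2
    have hle : (l : ℤ) ∣ e := hli.dvd_of_dvd_pow (n := 2) (by rw [← h2, mul_assoc]; exact dvd_mul_right _ _)
    obtain ⟨f, rfl⟩ := hle
    have h3 : (s : ℤ) * B = l * f ^ 2 := by
      apply mul_left_cancel₀ hli.ne_zero
      linear_combination h2
    have h4 : (l : ℤ) ∣ s * B := ⟨_, h3⟩
    have h5 : (l : ℤ) ∣ B := by
      rcases hli.dvd_or_dvd h4 with h | h
      · exact (hls (by exact_mod_cast h)).elim
      · exact h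
    have h6 := hp l hli (by push_cast; exact ⟨d ^ 2 * s, by ring⟩) h5
    have h7 : l ∣ 41 := by exact_mod_cast h6
    exact (Nat.prime_dvd_prime_iff_eq hl (by norm_num)).1 h7
  refine ⟨d, hd0, ?_⟩
  by_cases h1 : r = 1
  · left; rw [h1]; simp
  · right
    obtain ⟨l, hl, hlr⟩ := Nat.exists_prime_and_dvd h1
    obtain rfl := key l hl hlr
    obtain ⟨s, rfl⟩ := hlr
    by_cases hs : s = 1
    · rw [hs]; push_cast; ring
    · obtain ⟨l, hl, hls⟩ := Nat.exists_prime_and_dvd hs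
      obtain rfl := key l hl (hls.mul_left _)
      obtain ⟨k, rfl⟩ := hls
      have := hsq 41 ⟨k, by ring⟩
      exact absurd (Nat.isUnit_iff.1 this) (by norm_num)

set_option maxRecDepth 100000 in
lemma mod16 : ∀ a b : ZMod 16, 
    let m := (a ^ 2 + 4 * b ^ 2) * (-3 * a ^ 4 + 4 * a ^ 3 * b - 14 * a ^ 2 * b ^ 2 - 4 * a * b ^ 3 + b ^ 4)
    (m = 0 ∨ m = 1 ∨ m = 4 ∨ m = 9) →
    (8 * a = 0 ∧ 8 * b = 0) ∨ (8 * a = 8 ∧ 8 * b = 8) ∨ (4 * a = 0 ∧ 8 * b = 8) := by decide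

lemma sq16 : ∀ c : ZMod 16, c ^ 2 = 0 ∨ c ^ 2 = 1 ∨ c ^ 2 = 4 ∨ c ^ 2 = 9 := by decide

set_option maxRecDepth 100000 in
lemma mod13 : ∀ a b u : ZMod 13, a ^ 2 + 4 * b ^ 2 = 41 * u ^ 2 → ∀ v : ZMod 13,
    -3 * a ^ 4 + 4 * a ^ 3 * b - 14 * a ^ 2 * b ^ 2 - 4 * a * b ^ 3 + b ^ 4 = 41 * v ^ 2 → a = 0 ∧ b = 0 := by
  decide

lemma common41 {a b p : ℤ} (hab : IsCoprime a b) (hp : Prime p) (h1 : p ∣ a ^ 2 + 4 * b ^ 2)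
    (h2 : p ∣ -3 * a ^ 4 + 4 * a ^ 3 * b - 14 * a ^ 2 * b ^ 2 - 4 * a * b ^ 3 + b ^ 4) : p ∣ 41 := by
  have hb : ¬ p ∣ b := by
    intro hb
    have : p ∣ a ^ 2 := by
      have := dvd_sub h1 (hb.mul_right (4 * b))
      have e : a ^ 2 + 4 * b ^ 2 - b * (4 * b) = a ^ 2 := by ring
      rwa [e] at this
    exact hp.not_isUnit (hab.isUnit_of_dvd' (hp.dvd_of_dvd_pow this) hb)
  have h3 : p ∣ b ^ 2 * (5 * b - 2 * a) ^ 2 := by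
    have := dvd_sub h2 (h1.mul_right (-3 * a ^ 2 + 4 * a * b - 6 * b ^ 2))
    have e : -3 * a ^ 4 + 4 * a ^ 3 * b - 14 * a ^ 2 * b ^ 2 - 4 * a * b ^ 3 + b ^ 4 -
      (a ^ 2 + 4 * b ^ 2) * (-3 * a ^ 2 + 4 * a * b - 6 * b ^ 2) = b ^ 2 * (5 * b - 2 * a) ^ 2 := by ring
    rwa [e] at this
  have h4 : p ∣ 5 * b - 2 * a := by
    rcases hp.dvd_or_dvd h3 with h | h
    · exact (hb (hp.dvd_of_dvd_pow h)).elim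
    · exact hp.dvd_of_dvd_pow h
  have h5 : p ∣ 41 * b ^ 2 := by
    have := dvd_add (h4.mul_right (5 * b + 2 * a)) (h1.mul_left 4)
    have e : (5 * b - 2 * a) * (5 * b + 2 * a) + 4 * (a ^ 2 + 4 * b ^ 2) = 41 * b ^ 2 := by ring
    rwa [e] at this
  rcases hp.dvd_or_dvd h5 with h | h
  · exact h
  · exact (hb (hp.dvd_of_dvd_pow h)).elim

lemma int_sq_of {d N c : ℤ} (hd : d ≠ 0) (h : d ^ 2 * N = c ^ 2) : ∃ V, N = V ^ 2 := by
  have : d ∣ c := by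
    rw [← Int.pow_dvd_pow_iff (n := 2) (by norm_num), ← h]; exact dvd_mul_right _ _
  obtain ⟨V, rfl⟩ := this
  exact ⟨V, mul_left_cancel₀ (pow_ne_zero 2 hd) (by linear_combination h)⟩

lemma step0 {a b c : ℤ} (hab : IsCoprime a b)
    (h : (a ^ 2 + 4 * b ^ 2) * (-3 * a ^ 4 + 4 * a ^ 3 * b - 14 * a ^ 2 * b ^ 2 - 4 * a * b ^ 3 + b ^ 4) = c ^ 2) :
    4 ∣ a ∧ b % 2 = 1 ∧ (∃ u, a ^ 2 + 4 * b ^ 2 = u ^ 2) ∧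
      ∃ V, -3 * a ^ 4 + 4 * a ^ 3 * b - 14 * a ^ 2 * b ^ 2 - 4 * a * b ^ 3 + b ^ 4 = V ^ 2 := by
  have h16 := congrArg (Int.cast : ℤ → ZMod 16) h
  push_cast at h16
  have hm := mod16 a b (by have h0 := sq16 c; rw [← h16] at h0; exact h0)
  have cast16 : ∀ n : ℤ, ((n : ZMod 16) = 0) → 16 ∣ n := fun n hn => (ZMod.intCast_zmod_eq_zero_iff_dvd n 16).1 hn
  rcases hm with ⟨h1, h2⟩ | ⟨h1, h2⟩ | ⟨h1, h2⟩
  · exfalso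
    have ha := cast16 (8 * a) (by push_cast; exact h1)
    have hb := cast16 (8 * b) (by push_cast; exact h2)
    exact Int.prime_two.not_isUnit (hab.isUnit_of_dvd' (x := 2) (by omega) (by omega))
  · exfalso
    have ha := cast16 (8 * a - 8) (by push_cast; rw [h1, sub_self])
    have hb := cast16 (8 * b - 8) (by push_cast; rw [h2, sub_self])
    have hpos : 0 < a ^ 2 + 4 * b ^ 2 := by
      have : b ≠ 0 := by rintro rfl; omega
      positivity
    obtain ⟨d, -, hd⟩ := sq_or_41 hpos h (fun p hp => common41 hab hp)
    have key : ∀ x y z : ZMod 8, ¬ ((2 * x + 1) ^ 2 + 4 * (2 * y + 1) ^ 2 = z ^ 2) ∧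
      ¬ ((2 * x + 1) ^ 2 + 4 * (2 * y + 1) ^ 2 = 41 * z ^ 2) := by decide
    obtain ⟨x, rfl⟩ : ∃ x, a = 2 * x + 1 := ⟨a / 2, by omega⟩
    obtain ⟨y, rfl⟩ : ∃ x, b = 2 * x + 1 := ⟨b / 2, by omega⟩
    have k := key x y d
    rcases hd with hd | hd
    · have := congrArg (Int.cast : ℤ → ZMod 8) hd
      push_cast at this
      exact k.1 this
    · have := congrArg (Int.cast : ℤ → ZMod 8) hd
      push_cast at this
      exact k.2 this
  · have ha := cast16 (4 * a) (by push_cast; exact h1)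
    have hb := cast16 (8 * b - 8) (by push_cast; rw [h2, sub_self])
    have ha4 : 4 ∣ a := by omega
    have hb2 : b % 2 = 1 := by omega
    obtain ⟨N, hN⟩ : ∃ N, N = -3 * a ^ 4 + 4 * a ^ 3 * b - 14 * a ^ 2 * b ^ 2 - 4 * a * b ^ 3 + b ^ 4 := ⟨_, rfl⟩
    obtain ⟨k, hk⟩ := ha4
    have hM : a ^ 2 + 4 * b ^ 2 = 4 * (4 * k ^ 2 + b ^ 2) := by rw [hk]; ring
    rw [← hN] at h ⊢
    obtain ⟨c', rfl⟩ : (2 : ℤ) ∣ c := by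
      refine Int.prime_two.dvd_of_dvd_pow (n := 2) ?_
      rw [← h, hM]; exact ⟨2 * (4 * k ^ 2 + b ^ 2) * N, by ring⟩
    have h' : (4 * k ^ 2 + b ^ 2) * N = c' ^ 2 := by rw [hM] at h; linarith
    have hpos : 0 < 4 * k ^ 2 + b ^ 2 := by
      have : b ≠ 0 := by rintro rfl; omega
      positivity
    obtain ⟨d, hd0, hd⟩ := sq_or_41 hpos h' (fun p hp g1 g2 => common41 hab hp
      (by rw [hM]; exact g1.mul_left _) (by rw [← hN]; exact g2))
    rcases hd with hd | hd
    · refine ⟨⟨k, hk⟩, hb2, ⟨2 * d, by rw [hM, hd]; ring⟩, ?_⟩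
      rw [hd] at h'
      exact int_sq_of hd0 h'
    · exfalso
      rw [hd] at h'
      obtain ⟨e, he⟩ := int_sq_of (N := 41 * N) (c := c') hd0 (by linear_combination h')
      have p41 : Prime (41 : ℤ) := Int.prime_iff_natAbs_prime.2 (by norm_num)
      obtain ⟨v, rfl⟩ := p41.dvd_of_dvd_pow (n := 2) (a := e) ⟨N, he.symm⟩
      have hNv : N = 41 * v ^ 2 := by linarith
      have e1 : a ^ 2 + 4 * b ^ 2 = 41 * (2 * d) ^ 2 := by rw [hM, hd]; ring
      rw [hN] at hNv
      have e1' := congrArg (Int.cast : ℤ → ZMod 13) e1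
      have e2' := congrArg (Int.cast : ℤ → ZMod 13) hNv
      push_cast at e1' e2'
      obtain ⟨ka, kb⟩ := mod13 a b (2 * d) e1' v e2'
      have p13 : Prime (13 : ℤ) := Int.prime_iff_natAbs_prime.2 (by norm_num)
      exact p13.not_isUnit (hab.isUnit_of_dvd' ((ZMod.intCast_zmod_eq_zero_iff_dvd a 13).1 ka)
        ((ZMod.intCast_zmod_eq_zero_iff_dvd b 13).1 kb))

lemma step1 {a b u V : ℤ} (hb : 0 < b) (ha0 : a ≠ 0) (ha : 4 ∣ a) (hbo : b % 2 = 1)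
    (hu : a ^ 2 + 4 * b ^ 2 = u ^ 2)
    (hV : -3 * a ^ 4 + 4 * a ^ 3 * b - 14 * a ^ 2 * b ^ 2 - 4 * a * b ^ 3 + b ^ 4 = V ^ 2)
    (hV4 : V % 4 = 1) : False := by
  have haq : (a : ℚ) ≠ 0 := by exact_mod_cast ha0
  have hbq : (b : ℚ) ≠ 0 := by exact_mod_cast hb.ne'
  obtain ⟨x, hx⟩ : ∃ x : ℚ, x = (V + b ^ 2 - 2 * a * b - 3 * a ^ 2) / (2 * a ^ 2) := ⟨_, rfl⟩
  obtain ⟨y, hy⟩ : ∃ y : ℚ, y = (x - 3) * b / a - x - 1 := ⟨_, rfl⟩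
  have hVq : (-3 * a ^ 4 + 4 * a ^ 3 * b - 14 * a ^ 2 * b ^ 2 - 4 * a * b ^ 3 + b ^ 4 : ℚ) = V ^ 2 := by
    exact_mod_cast hV
  have huq : (a ^ 2 + 4 * b ^ 2 : ℚ) = u ^ 2 := by exact_mod_cast hu
  have hv : (V : ℚ) = 2 * a ^ 2 * x - b ^ 2 + 2 * a * b + 3 * a ^ 2 := by
    rw [hx]; field_simp; ring
  have hstar : (a : ℚ) ^ 2 * (x ^ 2 + 3 * x + 3) + 2 * a * b * (x + 1) - b ^ 2 * (x - 3) = 0 := by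
    have : (4 * a ^ 2 : ℚ) * ((a : ℚ) ^ 2 * (x ^ 2 + 3 * x + 3) + 2 * a * b * (x + 1) - b ^ 2 * (x - 3)) = 0 := by
      rw [hv] at hVq; linear_combination -hVq
    exact (mul_eq_zero.1 this).resolve_left (by positivity)
  have hay : (a : ℚ) * (x + y + 1) = b * (x - 3) := by rw [hy]; field_simp; ring
  have hE : y ^ 2 = x ^ 3 + x ^ 2 - 4 * x - 8 := by
    have : (a : ℚ) ^ 2 * (y ^ 2 - (x ^ 3 + x ^ 2 - 4 * x - 8)) = 0 := by
      have e : (a : ℚ) * y = b * (x - 3) - a * (x + 1) := by linear_combination hay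
      linear_combination (a * y + (b * (x - 3) - a * (x + 1))) * e - (x - 3) * hstar
    have := (mul_eq_zero.1 this).resolve_left (by positivity)
    linarith
  obtain ⟨X, Y, Z, r⟩ := exists_rep hE
  have hZq := r.zq
  -- the denominator is even
  have hZ : 2 ∣ Z := by
    have e : X * (2 * a ^ 2) = Z ^ 2 * (V + b ^ 2 - 2 * a * b - 3 * a ^ 2) := by
      have e' : (X * (2 * a ^ 2) : ℚ) = Z ^ 2 * (V + b ^ 2 - 2 * a * b - 3 * a ^ 2) := by
        rw [hv, r.hx]; field_simp; ring
      exact_mod_cast e'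
    obtain ⟨k, rfl⟩ := ha
    obtain ⟨v, rfl⟩ : ∃ v, V = 4 * v + 1 := ⟨V / 4, by omega⟩
    obtain ⟨m, rfl⟩ : ∃ m, b = 2 * m + 1 := ⟨b / 2, by omega⟩
    have e2 : Z ^ 2 * (2 * (v + m ^ 2 + m - 2 * k * (2 * m + 1) - 12 * k ^ 2) + 1) = 2 * (8 * (X * k ^ 2)) := by
      linarith
    rcases Int.prime_two.dvd_or_dvd ⟨_, e2⟩ with h | h
    · exact Int.prime_two.dvd_of_dvd_pow h
    · omega
  have hXo := r.X_odd
  have hodd : (X + Z ^ 2) % 2 = 1 := by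
    obtain ⟨k, rfl⟩ := hZ
    ring_nf; omega
  have hpos : 0 < X + Z ^ 2 := by have := r.X_pos; positivity
  have hsq : (u * (x + y + 1) / b * Z ^ 3) ^ 2 = (((X + Z ^ 2) * (4 * X ^ 2 + 5 * X * Z ^ 2 - 19 * Z ^ 4 + 8 * Y * Z) : ℤ) : ℚ) := by
    have e1 : (x + 1) * (4 * x ^ 2 + 5 * x - 19 + 8 * y) * b ^ 2 = u ^ 2 * (x + y + 1) ^ 2 := by
      rw [← huq]
      linear_combination (-(a * (x + y + 1) + b * (x - 3))) * hay - 4 * b ^ 2 * hE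
    have e2 : (u * (x + y + 1) / b * Z ^ 3) ^ 2 = (x + 1) * (4 * x ^ 2 + 5 * x - 19 + 8 * y) * Z ^ 6 := by
      field_simp
      linear_combination -e1
    rw [e2, r.hx, r.hy]
    push_cast
    field_simp
  obtain ⟨n, hn⟩ := int_of_sq hsq
  rw [hn] at hsq
  have hsqi : (X + Z ^ 2) * (4 * X ^ 2 + 5 * X * Z ^ 2 - 19 * Z ^ 4 + 8 * Y * Z) = n ^ 2 := by exact_mod_cast hsq.symm
  obtain ⟨d, -, hd⟩ := sq_or_41 hpos hsqi (by
    intro p hp h1 h2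
    have hp2 : ¬ p ∣ 2 := by
      intro h3
      have := (hp.associated_of_dvd Int.prime_two h3).symm.dvd.trans h1
      omega
    have hpZ : ¬ p ∣ Z := by
      intro hpZ
      refine r.not_dvd hp ?_ hpZ
      have := dvd_sub h1 (hpZ.mul_right Z)
      have e : X + Z ^ 2 - Z * Z = X := by ring
      rwa [e] at this
    have h3 : p ∣ 2 ^ 2 * (2 * Y * Z - 5 * Z ^ 4) := by
      have := dvd_sub h2 (h1.mul_right (4 * X + Z ^ 2))
      have e : 4 * X ^ 2 + 5 * X * Z ^ 2 - 19 * Z ^ 4 + 8 * Y * Z - (X + Z ^ 2) * (4 * X + Z ^ 2) =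
        2 ^ 2 * (2 * Y * Z - 5 * Z ^ 4) := by ring
      rwa [e] at this
    have h4 : p ∣ 2 * Y * Z - 5 * Z ^ 4 := by
      rcases hp.dvd_or_dvd h3 with h | h
      · exact (hp2 (hp.dvd_of_dvd_pow h)).elim
      · exact h
    have h5 : p ∣ 41 * Z ^ 8 := by
      have := dvd_sub (h1.mul_right (4 * Z ^ 2 * (X ^ 2 - 4 * Z ^ 4))) (h4.mul_right (2 * Y * Z + 5 * Z ^ 4))
      have e : (X + Z ^ 2) * (4 * Z ^ 2 * (X ^ 2 - 4 * Z ^ 4)) - (2 * Y * Z - 5 * Z ^ 4) * (2 * Y * Z + 5 * Z ^ 4) = 41 * Z ^ 8 := by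
        linear_combination (-4 * Z ^ 2) * r.eq
      rwa [e] at this
    rcases hp.dvd_or_dvd h5 with h | h
    · exact h
    · exact (hpZ (hp.dvd_of_dvd_pow h)).elim)
  rcases hd with hd | hd
  · exact no_square hE r hZ hd
  · have h3 := r.mod3.1
    rw [hd] at h3
    rcases (by omega : d % 3 = 0 ∨ d % 3 = 1 ∨ d % 3 = 2) with h | h | h <;>
      simp [Int.mul_emod, pow_two, h] at h3

lemma final_aux {x y : ℚ} (h : y ^ 2 = -3 * x ^ 6 + 4 * x ^ 5 - 26 * x ^ 4 + 12 * x ^ 3 -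
          55 * x ^ 2 - 16 * x + 4) : x = 0 := by
  obtain ⟨a, ha⟩ : ∃ a, a = x.num := ⟨_, rfl⟩
  obtain ⟨b, hb⟩ : ∃ b : ℤ, b = x.den := ⟨_, rfl⟩
  have hbpos : 0 < b := by rw [hb]; exact_mod_cast x.den_pos
  have hcop : IsCoprime a b := by
    rw [ha, hb, Int.isCoprime_iff_gcd_eq_one]; exact x.reduced
  have hbq : (b : ℚ) ≠ 0 := by exact_mod_cast hbpos.ne'
  have hx : x = a / b := by rw [ha, hb]; exact_mod_cast (Rat.num_div_den x).symm
  have h1 : (y * b ^ 3) ^ 2 = (((a ^ 2 + 4 * b ^ 2) * (-3 * a ^ 4 + 4 * a ^ 3 * b - 14 * a ^ 2 * b ^ 2 - 4 * a * b ^ 3 + b ^ 4) : ℤ) : ℚ) := by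
    rw [mul_pow, h, hx]; push_cast; field_simp; ring
  obtain ⟨c, hc⟩ := int_of_sq h1
  rw [hc] at h1
  obtain ⟨ha4, hb2, ⟨u, hu⟩, V, hV⟩ := step0 hcop (c := c) (by exact_mod_cast h1.symm)
  by_contra hx0
  have ha0 : a ≠ 0 := by rintro rfl; apply hx0; rw [hx]; simp
  have hVo : V % 2 = 1 := by
    by_contra hc
    obtain ⟨w, rfl⟩ : ∃ w, V = 2 * w := ⟨V / 2, by omega⟩
    obtain ⟨k, rfl⟩ := ha4
    obtain ⟨m, rfl⟩ : ∃ m, b = 2 * m + 1 := ⟨b / 2, by omega⟩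
    ring_nf at hV
    omega
  rcases (by omega : V % 4 = 1 ∨ (-V) % 4 = 1) with h4 | h4
  · exact step1 hbpos ha0 ha4 hb2 hu hV h4
  · exact step1 hbpos ha0 ha4 hb2 hu (by rw [neg_sq]; exact hV) h4

end

/-- The only rational points on the genus 2 curve
`y² = -3x⁶ + 4x⁵ - 26x⁴ + 12x³ - 55x² - 16x + 4` are `(0, ±2)`. -/
theorem stmt_14 :
    {p : ℚ × ℚ |
        p.2 ^ 2 = -3 * p.1 ^ 6 + 4 * p.1 ^ 5 - 26 * p.1 ^ 4 + 12 * p.1 ^ 3 -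
          55 * p.1 ^ 2 - 16 * p.1 + 4} =
      ({(0, 2), (0, -2)} : Set (ℚ × ℚ)) := by
  ext ⟨x, y⟩
  simp only [Set.mem_ofPred_eq, Set.mem_insert_iff, Set.mem_singleton_iff, Prod.mk.injEq]
  constructor
  · intro h
    have hx := final_aux h
    subst hx
    have h2 : (y - 2) * (y + 2) = 0 := by linear_combination h
    rcases mul_eq_zero.1 h2 with h3 | h3
    · left; exact ⟨rfl, by linarith⟩
    · right; exact ⟨rfl, by linarith⟩
  · rintro (⟨rfl, rfl⟩ | ⟨rfl, rfl⟩) <;> norm_num
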